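/- arXiv:math/0204065 — 6 statements merged into one kernel-verified Lean document; each statement's English description precedes it below -/
import Mathlib

section
/- Let M be a finitely generated ℤ-module and γ : M → M an automorphism. Let M^γ = ker(γ − 1 : M → M), let M_γ = coker(γ − 1 : M → M), and let f : M^γ → M_γ be the homomorphism induced by the identity map of M (inclusion followed by projection). Then z(f) is defined if and only if 1 is not a multiple root of the minimal polynomial of γ acting on M ⊗ ℚ. In that case, writing the characteristic polynomial of γ on M ⊗ ℚ as (t − 1)^m · g(t) with g ∈ ℚ[t] and g(1) ≠ 0, one has z(f) · |g(1)| = 1 (equivalently, z(f)·|∏_{a_i ≠ 1}(1 − a_i)| = 1, where (a_i) is the family of complex eigenvalues of γ on M ⊗ ℚ counted with multiplicity). -/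
open Polynomial TensorProduct

/-- `z(f)` is *defined* for a homomorphism of abelian groups `f : M →+ N` when both its
kernel and its cokernel are finite. -/
def ZDefined {M N : Type*} [AddCommGroup M] [AddCommGroup N] (f : M →+ N) : Prop :=
  Finite f.ker ∧ Finite (N ⧸ f.range)

/-- `z(f) = [ker f] / [coker f] ∈ ℚ` for a homomorphism of abelian groups. -/
noncomputable def zval {M N : Type*} [AddCommGroup M] [AddCommGroup N] (f : M →+ N) : ℚ :=
  (Nat.card f.ker : ℚ) / (Nat.card (N ⧸ f.range) : ℚ)

/-- A finite kernel scales the index of the range of an endomorphism by the kernel's order. -/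
theorem index_range_eq_card_ker_mul_relIndex {N W : Type*} [AddCommGroup N] [AddCommGroup W]
    (p : N →+ W) [Finite p.ker] (d : N →+ N) (D : W →+ W) (hD : Function.Injective D)
    (h : ∀ x, p (d x) = D (p x)) :
    d.range.index = Nat.card d.ker * (p.range.map D).relIndex p.range := by
  have hker : d.ker ≤ p.ker := fun x hx => by
    rw [AddMonoidHom.mem_ker] at hx ⊢
    apply hD
    rw [← h, hx, map_zero, map_zero]
  have hmapker : p.ker.map d ≤ p.ker := by
    rintro _ ⟨x, hx, rfl⟩
    have hx : p x = 0 := hx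
    rw [AddMonoidHom.mem_ker, h, hx, map_zero]
  have hinf : d.range ⊓ p.ker = p.ker.map d := by
    refine le_antisymm ?_ (le_inf ?_ hmapker)
    · rintro _ ⟨⟨x, rfl⟩, hx⟩
      refine ⟨x, ?_, rfl⟩
      have hx : p (d x) = 0 := hx
      change p x = 0
      apply hD
      rw [← h, hx, map_zero]
    · rintro _ ⟨x, -, rfl⟩
      exact ⟨x, rfl⟩
  have hmap : d.range.map p = p.range.map D := by
    ext w
    simp only [AddSubgroup.mem_map, AddMonoidHom.mem_range, exists_exists_eq_and, h]
  have hindex : (d.range ⊔ p.ker).index = (p.range.map D).relIndex p.range := by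
    rw [← AddSubgroup.comap_map_eq, AddSubgroup.index_comap, hmap]
  have hrel : d.range.relIndex (d.range ⊔ p.ker) = (p.ker.map d).relIndex p.ker := by
    rw [AddSubgroup.relIndex_sup_left, ← hinf, AddSubgroup.inf_relIndex_right]
  have hdom : Nat.card d.ker * Nat.card (p.ker.map d) = Nat.card p.ker := by
    rw [← AddSubgroup.relIndex_ker, ← AddSubgroup.relIndex_bot_left,
      ← AddSubgroup.relIndex_bot_left, AddSubgroup.relIndex_mul_relIndex _ _ _ bot_le hker]
  have hcod : Nat.card (p.ker.map d) * (p.ker.map d).relIndex p.ker = Nat.card p.ker := by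
    rw [← AddSubgroup.relIndex_bot_left, AddSubgroup.relIndex_mul_relIndex _ _ _ bot_le hmapker,
      AddSubgroup.relIndex_bot_left]
  have hpos : 0 < Nat.card (p.ker.map d) := by
    have : Finite (p.ker.map d) := Set.Finite.image d (Set.toFinite (p.ker : Set N))
    exact Nat.card_pos
  have hcard : (p.ker.map d).relIndex p.ker = Nat.card d.ker :=
    Nat.eq_of_mul_eq_mul_left hpos (by rw [hcod, mul_comm, hdom])
  rw [← AddSubgroup.relIndex_mul_index (le_sup_left : d.range ≤ d.range ⊔ p.ker), hindex, hrel,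
    hcard]

/-- An endomorphism preserving a full lattice in a rational vector space maps it to a sublattice
whose index is the absolute value of the determinant. -/
theorem relIndex_map_eq_abs_det {W : Type*} [AddCommGroup W] [Module ℚ W] (L : Submodule ℤ W)
    [L.IsLattice ℚ] (D : W →ₗ[ℚ] W) (hD : Function.Injective D)
    (hL : ∀ x ∈ L, D x ∈ L) :
    ((L.toAddSubgroup.map D.toAddMonoidHom).relIndex L.toAddSubgroup : ℚ) =
      |LinearMap.det D| := by
  classical
  have : Module.Finite ℤ L := Submodule.IsLattice.finite ℚ L
  let b := Module.Free.chooseBasis ℤ L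
  let b₂ := b.extendOfIsLattice ℚ
  have : FiniteDimensional ℚ W := Module.Finite.of_basis b₂
  let b₁ := b₂.map (LinearEquiv.ofInjectiveEndo D hD)
  have hb₂ : L.toAddSubgroup = AddSubgroup.closure (Set.range b₂) := by
    rw [← Submodule.span_int_eq_addSubgroupClosure]
    have hr : Set.range b₂ = L.subtype '' Set.range b := by
      rw [← Set.range_comp]
      congr 1
      ext i
      simp [b₂]
    rw [hr, Submodule.span_image, b.span_eq, Submodule.map_top, Submodule.range_subtype]
  have hb₁ : L.toAddSubgroup.map D.toAddMonoidHom = AddSubgroup.closure (Set.range b₁) := by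
    have hr : Set.range b₁ = D.toAddMonoidHom '' Set.range b₂ := by
      rw [← Set.range_comp]
      congr 1
    rw [hr, ← AddMonoidHom.map_closure, ← hb₂]
  rw [AddSubgroup.relIndex_eq_abs_det _ _ _ b₁ b₂ hb₁ hb₂]
  · congr 1
    have : (b₁ : _ → W) = D ∘ b₂ := by
      ext i
      simp [b₁]
    rw [this, Module.Basis.det_comp_basis]
    simp
  · rintro _ ⟨x, hx, rfl⟩
    exact hL x hx

/-- Let `d` be an endomorphism of an abelian group `N` and `D` the endomorphism
it induces on a rational vector space `W` which is a rationalization of `N`. If `d` has finite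
kernel, then `D` is injective. -/
theorem injective_of_finite_ker {N W : Type*} [AddCommGroup N]
    [AddCommGroup W] [Module ℚ W] (p : N →ₗ[ℤ] W)
    [IsLocalizedModule (nonZeroDivisors ℤ) p] (d : N →+ N) (D : W →ₗ[ℚ] W)
    (h : ∀ x, p (d x) = D (p x)) [Finite d.ker] : Function.Injective D := by
  rw [injective_iff_map_eq_zero]
  intro w hw
  obtain ⟨⟨x, n⟩, hn⟩ := IsLocalizedModule.surj (nonZeroDivisors ℤ) p w
  have hn0 : (n : ℤ) ≠ 0 := nonZeroDivisors.coe_ne_zero n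
  have hn : (n : ℤ) • w = p x := hn
  have hdx : p (d x) = 0 := by rw [h, ← hn, map_zsmul, hw, smul_zero]
  obtain ⟨k, hk⟩ := (IsLocalizedModule.eq_zero_iff (nonZeroDivisors ℤ) p).1 hdx
  have hk : (k : ℤ) • d x = 0 := hk
  have hkx : (k : ℤ) • x ∈ d.ker := by rw [AddMonoidHom.mem_ker, map_zsmul, hk]
  have hcard : Nat.card d.ker • (k : ℤ) • x = 0 :=
    congrArg Subtype.val (card_nsmul_eq_zero' (G := d.ker) (x := ⟨_, hkx⟩))
  have hk0 : (k : ℤ) ≠ 0 := nonZeroDivisors.coe_ne_zero k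
  have hpx : Nat.card d.ker • (k : ℤ) • (n : ℤ) • w = 0 := by
    rw [hn, ← map_zsmul, ← map_nsmul, hcard, map_zero]
  have hc : Nat.card d.ker ≠ 0 := Nat.card_pos.ne'
  rw [← Nat.cast_smul_eq_nsmul ℚ, ← Int.cast_smul_eq_zsmul ℚ, ← Int.cast_smul_eq_zsmul ℚ] at hpx
  simp only [smul_eq_zero, Nat.cast_eq_zero, Int.cast_eq_zero, hc, hk0, hn0, false_or] at hpx
  exact hpx

/-- Let `d` be an endomorphism of a finitely generated abelian group `N` such that the induced
endomorphism `D` of the rationalization `W` of `N` is injective. Then the kernel and the cokernel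
of `d` are finite and the quotient of their orders is the absolute value of `det D`. -/
theorem index_range_eq_card_ker_mul_abs_det {N W : Type*} [AddCommGroup N] [Module.Finite ℤ N]
    [AddCommGroup W] [Module ℚ W] (p : N →ₗ[ℤ] W)
    [IsLocalizedModule (nonZeroDivisors ℤ) p] (d : N →+ N) (D : W →ₗ[ℚ] W)
    (h : ∀ x, p (d x) = D (p x)) (hD : Function.Injective D) :
    Finite d.ker ∧ (d.range.index : ℚ) = Nat.card d.ker * |LinearMap.det D| := by
  have htors : Module.IsTorsion ℤ (LinearMap.ker p) := by
    rintro ⟨x, hx⟩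
    obtain ⟨k, hk⟩ := (IsLocalizedModule.eq_zero_iff (nonZeroDivisors ℤ) p).1 hx
    exact ⟨k, Subtype.ext hk⟩
  have hfin : Finite (LinearMap.ker p) := Module.finite_of_fg_torsion _ htors
  have hfin' : Finite p.toAddMonoidHom.ker := hfin
  have hle : d.ker ≤ p.toAddMonoidHom.ker := fun x hx => by
    have hx : d x = 0 := hx
    change p x = 0
    apply hD
    rw [← h, hx, map_zero, map_zero]
  have hlat : (LinearMap.range p).IsLattice ℚ :=
    { fg := LinearMap.range_eq_map p ▸ Module.Finite.fg_top.map p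
      span_eq_top := by
        have := span_eq_top_of_isLocalizedModule ℚ (nonZeroDivisors ℤ) p
          (v := Set.univ) Submodule.span_univ
        rwa [Set.image_univ, ← LinearMap.coe_range] at this }
  refine ⟨Finite.of_injective _ (AddSubgroup.inclusion_injective hle), ?_⟩
  rw [index_range_eq_card_ker_mul_relIndex p.toAddMonoidHom d D.toAddMonoidHom hD h, Nat.cast_mul,
    ← relIndex_map_eq_abs_det (LinearMap.range p) D hD]
  · rfl
  · rintro _ ⟨x, rfl⟩
    exact ⟨d x, h x⟩

/-- Restriction of an endomorphism to its range. -/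
noncomputable def endoOnRange {K V : Type*} [CommRing K] [AddCommGroup V] [Module K V]
    (D : V →ₗ[K] V) : LinearMap.range D →ₗ[K] LinearMap.range D :=
  D.restrict fun x _ => LinearMap.mem_range_self D x

/-- An endomorphism is injective on its range iff its square has the same kernel. -/
theorem endoOnRange_injective_iff {K V : Type*} [CommRing K] [AddCommGroup V] [Module K V]
    (D : V →ₗ[K] V) :
    Function.Injective (endoOnRange D) ↔ ∀ v, D (D v) = 0 → D v = 0 := by
  rw [injective_iff_map_eq_zero]
  constructor
  · intro h v hv
    exact congrArg Subtype.val (h ⟨D v, v, rfl⟩ (Subtype.ext hv))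
  · rintro h ⟨_, v, rfl⟩ hv
    exact Subtype.ext (h v (congrArg Subtype.val hv))

/-- `φ - 1` is injective on its range iff `1` is not a multiple root of the minimal polynomial. -/
theorem endoOnRange_sub_one_injective_iff {K V : Type*} [Field K] [AddCommGroup V] [Module K V]
    [FiniteDimensional K V] (φ : V →ₗ[K] V) :
    Function.Injective (endoOnRange (φ - 1)) ↔ ¬ (X - 1) ^ 2 ∣ minpoly K φ := by
  have hX : aeval φ (X - 1 : K[X]) = φ - 1 := by simp
  have hX0 : (X - 1 : K[X]) ≠ 0 := X_sub_C_ne_zero 1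
  rw [endoOnRange_injective_iff]
  constructor
  · rintro h ⟨q, hq⟩
    have hzero : aeval φ ((X - 1) * q) = 0 := by
      ext v
      have h0 : aeval φ ((X - 1) * ((X - 1) * q)) v = 0 := by
        rw [← mul_assoc, ← sq, ← hq, minpoly.aeval, LinearMap.zero_apply]
      rw [map_mul, map_mul, hX] at h0
      rw [map_mul, hX]
      exact h _ h0
    have hdvd : minpoly K φ ∣ (X - 1) * q := minpoly.dvd K φ hzero
    have hm : minpoly K φ ≠ 0 := minpoly.ne_zero (Algebra.IsIntegral.isIntegral φ)
    have hq0 : (X - 1) * q ≠ 0 := by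
      rintro h0
      apply hm
      rw [hq, sq, mul_assoc, h0, mul_zero]
    rw [hq, sq, mul_assoc] at hdvd
    have hu : IsUnit (X - 1 : K[X]) :=
      isUnit_of_dvd_one ((mul_dvd_mul_iff_right hq0).1 (by simpa using hdvd))
    exact not_isUnit_X_sub_C (1 : K) hu
  · intro h v hv
    have hirr : Irreducible (X - 1 : K[X]) := irreducible_X_sub_C 1
    have hbez : ∃ a b : K[X], X - 1 = a * (X - 1) ^ 2 + b * minpoly K φ := by
      by_cases h1 : (X - 1) ∣ minpoly K φ
      · obtain ⟨q, hq⟩ := h1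
        have hnd : ¬ (X - 1) ∣ q := by
          rintro ⟨r, rfl⟩
          exact h ⟨r, by rw [hq]; ring⟩
        obtain ⟨a, b, hab⟩ := (hirr.coprime_iff_not_dvd).2 hnd
        refine ⟨a, b, ?_⟩
        rw [hq]
        linear_combination (1 - X) * hab
      · obtain ⟨a, b, hab⟩ := (hirr.coprime_iff_not_dvd).2 h1
        refine ⟨a, b * (X - 1), ?_⟩
        linear_combination (1 - X) * hab
    obtain ⟨a, b, hab⟩ := hbez
    have hφ := congrArg (fun P => aeval φ P v) hab
    simp only [map_add, map_mul, hX, minpoly.aeval, mul_zero, add_zero,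
      Module.End.mul_apply, sq, hv, map_zero] at hφ
    exact hφ

/-- If `φ - 1` is injective on its range, the absolute value of its determinant there is the value
at `1` of the prime-to-`X - 1` part of the characteristic polynomial of `φ`. -/
theorem abs_det_endoOnRange_sub_one {K V : Type*} [Field K] [LinearOrder K] [IsStrictOrderedRing K]
    [AddCommGroup V] [Module K V]
    [FiniteDimensional K V] (φ : V →ₗ[K] V) (hinj : Function.Injective (endoOnRange (φ - 1)))
    (m : ℕ) (g : K[X]) (hchar : φ.charpoly = (X - 1) ^ m * g) (hg : g.eval 1 ≠ 0) :
    |LinearMap.det (endoOnRange (φ - 1))| = |g.eval 1| := by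
  set D : V →ₗ[K] V := φ - 1 with hD
  have hφ : φ = D + 1 := by rw [hD]; abel
  have hdisj : Disjoint (LinearMap.ker D) (LinearMap.range D) := by
    rw [Submodule.disjoint_def]
    rintro _ h ⟨v, rfl⟩
    exact (endoOnRange_injective_iff D).1 hinj v h
  have hcompl : IsCompl (LinearMap.ker D) (LinearMap.range D) :=
    (Submodule.isCompl_iff_disjoint _ _
      (by rw [add_comm, LinearMap.finrank_range_add_finrank_ker])).2 hdisj
  let e := Submodule.prodEquivOfIsCompl _ _ hcompl
  have hconj : e.symm.conj φ = LinearMap.prodMap 1 (endoOnRange D + 1) := by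
    refine LinearMap.ext fun x => ?_
    have hx : D x.1 = 0 := x.1.2
    rw [LinearEquiv.conj_apply, LinearEquiv.symm_symm, LinearMap.comp_apply, LinearMap.comp_apply,
      LinearEquiv.coe_coe, LinearEquiv.coe_coe, LinearEquiv.symm_apply_eq]
    simp only [e, Submodule.coe_prodEquivOfIsCompl', hφ, LinearMap.add_apply, Module.End.one_apply,
      map_add, hx, zero_add, LinearMap.prodMap_apply, Submodule.coe_add]
    rfl
  have hmul : φ.charpoly = (X - 1) ^ Module.finrank K (LinearMap.ker D) *
      (endoOnRange D + 1).charpoly := by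
    rw [← e.symm.charpoly_conj φ, hconj, LinearMap.charpoly_prodMap, LinearMap.charpoly_one]
  have heval : (endoOnRange D + 1).charpoly.eval 1 =
      (-1) ^ Module.finrank K (LinearMap.range D) * LinearMap.det (endoOnRange D) := by
    rw [LinearMap.eval_charpoly, map_one, sub_add_cancel_right, ← LinearMap.det_smul]
    congr 1
    ext x
    simp
  have hdet : LinearMap.det (endoOnRange D) ≠ 0 := by
    have := LinearMap.ker_eq_bot.2 hinj
    rwa [Ne, LinearMap.det_eq_zero_iff_ker_ne_bot, not_not]
  have key : ∀ (n : ℕ) (P : K[X]), P.eval 1 ≠ 0 → ((X - 1) ^ n * P).rootMultiplicity 1 = n := by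
    intro n P hP
    have hP0 : P ≠ 0 := by rintro rfl; simp at hP
    rw [← C_1, rootMultiplicity_mul
      (mul_ne_zero (pow_ne_zero _ (X_sub_C_ne_zero 1)) hP0), rootMultiplicity_X_sub_C_pow,
      rootMultiplicity_eq_zero hP, add_zero]
  have hne : (endoOnRange D + 1).charpoly.eval 1 ≠ 0 := by
    rw [heval]
    exact mul_ne_zero (by simp) hdet
  have hm : m = Module.finrank K (LinearMap.ker D) := by
    rw [← key m g hg, ← hchar, hmul, key _ _ hne]
  have hgE : g = (endoOnRange D + 1).charpoly := by
    have : (X - 1 : K[X]) ^ m ≠ 0 := pow_ne_zero _ (X_sub_C_ne_zero 1)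
    apply mul_left_cancel₀ this
    rw [← hchar, hmul, hm]
  rw [hgE, heval, abs_mul, abs_pow, abs_neg, abs_one, one_pow, one_mul]

/-- The homomorphism induced by the identity from the kernel to the cokernel of `δ` has the same
kernel and cokernel orders as the restriction of `δ` to its range. -/
theorem card_ker_eq_and_index_range_eq {M : Type*} [AddCommGroup M] (δ : M →+ M)
    (f : δ.ker →+ M ⧸ δ.range) (hf : ∀ x : δ.ker, f x = QuotientAddGroup.mk (x : M))
    (d : δ.range →+ δ.range) (hd : ∀ x, (d x : M) = δ x) :
    Nonempty (f.ker ≃ d.ker) ∧ f.range.index = d.range.index := by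
  have hfmem (x : δ.ker) : x ∈ f.ker ↔ (x : M) ∈ δ.range := by
    rw [AddMonoidHom.mem_ker, hf, QuotientAddGroup.eq_zero_iff]
  have hdmem (x : δ.range) : x ∈ d.ker ↔ (x : M) ∈ δ.ker := by
    rw [AddMonoidHom.mem_ker, AddMonoidHom.mem_ker, ← hd, ZeroMemClass.coe_eq_zero]
  refine ⟨⟨⟨fun x => ⟨⟨x, (hfmem _).1 x.2⟩, (hdmem _).2 x.1.2⟩,
    fun x => ⟨⟨x, (hdmem _).1 x.2⟩, (hfmem _).2 x.1.2⟩, fun _ => rfl, fun _ => rfl⟩⟩, ?_⟩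
  have h1 : f.range = δ.ker.map (QuotientAddGroup.mk' δ.range) := by
    ext y
    constructor
    · rintro ⟨x, rfl⟩
      exact ⟨x, x.2, (hf x).symm⟩
    · rintro ⟨x, hx, rfl⟩
      exact ⟨⟨x, hx⟩, hf _⟩
  have h2 : d.range = (δ.range.map δ).comap δ.range.subtype := by
    ext y
    constructor
    · rintro ⟨x, rfl⟩
      exact ⟨x, x.2, (hd x).symm⟩
    · rintro ⟨x, hx, hxy⟩
      exact ⟨⟨x, hx⟩, Subtype.ext ((hd _).trans hxy)⟩
  rw [← AddSubgroup.index_comap_of_surjective f.range (QuotientAddGroup.mk'_surjective δ.range), h1,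
    AddSubgroup.comap_map_eq, QuotientAddGroup.ker_mk', h2, AddSubgroup.index_comap,
    AddSubgroup.range_subtype, ← AddSubgroup.index_comap, AddSubgroup.comap_map_eq, sup_comm]

/-- Being a localized module does not depend on the chosen `ℤ`-module structure of the target. -/
theorem isLocalizedModule_toIntLinearMap {M V : Type*} [AddCommGroup M] [AddCommGroup V]
    [inst : Module ℤ V] (S : Submonoid ℤ) (p : M →ₗ[ℤ] V) [h : IsLocalizedModule S p] :
    @IsLocalizedModule ℤ _ M V _ _ _ (AddCommGroup.toIntModule V) S
      p.toAddMonoidHom.toIntLinearMap := by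
  obtain rfl : inst = AddCommGroup.toIntModule V := Subsingleton.elim _ _
  exact h

/-- If the endomorphism `D` of a rational vector space `V` is the rationalization of `δ`, then
the range of `D` is the rationalization of the range of `δ`. -/
theorem isLocalizedModule_rangeRestrict {M V : Type*} [AddCommGroup M] [AddCommGroup V]
    [Module ℚ V] (p : M →ₗ[ℤ] V) [IsLocalizedModule (nonZeroDivisors ℤ) p]
    (δ : M →+ M) (D : V →ₗ[ℚ] V) (h : ∀ x, p (δ x) = D (p x))
    (q : δ.range →ₗ[ℤ] LinearMap.range D) (hq : ∀ x, (q x : V) = p x) :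
    IsLocalizedModule (nonZeroDivisors ℤ) q where
  map_units n := by
    have hn : ((n : ℤ) : ℚ) ≠ 0 := Int.cast_ne_zero.2 (nonZeroDivisors.coe_ne_zero n)
    rw [Module.End.isUnit_iff]
    constructor
    · intro x y hxy
      have hxy : (n : ℤ) • x = (n : ℤ) • y := hxy
      rw [← Int.cast_smul_eq_zsmul ℚ, ← Int.cast_smul_eq_zsmul ℚ] at hxy
      exact smul_right_injective _ hn hxy
    · intro y
      refine ⟨((n : ℤ) : ℚ)⁻¹ • y, ?_⟩
      change (n : ℤ) • ((n : ℤ) : ℚ)⁻¹ • y = y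
      rw [← Int.cast_smul_eq_zsmul ℚ, smul_inv_smul₀ hn]
  surj := by
    rintro ⟨_, v, rfl⟩
    obtain ⟨⟨x, n⟩, hn⟩ := IsLocalizedModule.surj (nonZeroDivisors ℤ) p v
    have hn : (n : ℤ) • v = p x := hn
    refine ⟨⟨⟨δ x, x, rfl⟩, n⟩, Subtype.ext ?_⟩
    change (n : ℤ) • D v = q ⟨δ x, x, rfl⟩
    rw [hq, ← map_zsmul, hn, ← h]
  exists_of_eq {x y} hxy := by
    have hp : p x = p y := by rw [← hq, ← hq, hxy]
    obtain ⟨c, hc⟩ := IsLocalizedModule.exists_of_eq (S := nonZeroDivisors ℤ) hp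
    exact ⟨c, Subtype.ext hc⟩

/-- Let `M` be a finitely generated `ℤ`-module, `γ : M ≃+ M` an automorphism, and let
`f : ker(γ - 1) → coker(γ - 1)` be induced by the identity of `M`.  Then `z(f)` is
defined iff `1` is not a multiple root of the minimal polynomial of `γ` on `M ⊗ ℚ`;
and, writing the characteristic polynomial of `γ` on `M ⊗ ℚ` as `(t - 1)^m * g(t)`
with `g(1) ≠ 0`, in that case `z(f) * |g(1)| = 1`. -/
theorem stmt3 {M : Type*} [AddCommGroup M] [Module.Finite ℤ M]
    (γ : M ≃+ M)
    (φ : (ℚ ⊗[ℤ] M) →ₗ[ℚ] (ℚ ⊗[ℤ] M))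
    (hφ : φ = LinearMap.baseChange ℚ (γ : M →+ M).toIntLinearMap)
    (δ : M →+ M) (hδ : δ = (γ : M →+ M) - AddMonoidHom.id M)
    (f : δ.ker →+ M ⧸ δ.range)
    (hf : ∀ x : δ.ker, f x = QuotientAddGroup.mk (x : M))
    (m : ℕ) (g : Polynomial ℚ)
    (hchar : LinearMap.charpoly φ = (X - 1) ^ m * g)
    (hg1 : g.eval 1 ≠ 0) :
    (ZDefined f ↔ ¬ (X - 1) ^ 2 ∣ minpoly ℚ φ) ∧
      (¬ (X - 1) ^ 2 ∣ minpoly ℚ φ → zval f * |g.eval 1| = 1) := by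
  let p : M →ₗ[ℤ] ℚ ⊗[ℤ] M := (TensorProduct.mk ℤ ℚ M 1).toAddMonoidHom.toIntLinearMap
  have hmk : IsLocalizedModule (nonZeroDivisors ℤ) (TensorProduct.mk ℤ ℚ M 1) :=
    (isLocalizedModule_iff_isBaseChange (nonZeroDivisors ℤ) ℚ _).2
      (TensorProduct.isBaseChange ℤ M ℚ)
  have hloc : IsLocalizedModule (nonZeroDivisors ℤ) p :=
    isLocalizedModule_toIntLinearMap _ (TensorProduct.mk ℤ ℚ M 1)
  have hD (x : M) : p (δ x) = (φ - 1) (p x) := by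
    subst hφ hδ
    simp [p, TensorProduct.tmul_sub]
  let d : δ.range →+ δ.range := (δ.comp δ.range.subtype).codRestrict δ.range fun x => ⟨x, rfl⟩
  let q : δ.range →ₗ[ℤ] LinearMap.range (φ - 1) :=
    AddMonoidHom.toIntLinearMap
      ((p.toAddMonoidHom.comp δ.range.subtype).codRestrict
        (LinearMap.range (φ - 1)).toAddSubgroup (by rintro ⟨_, x, rfl⟩; exact ⟨_, (hD x).symm⟩))
  have hq : IsLocalizedModule (nonZeroDivisors ℤ) q :=
    isLocalizedModule_rangeRestrict p δ (φ - 1) hD q fun _ => rfl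
  have hqd (x : δ.range) : q (d x) = endoOnRange (φ - 1) (q x) := Subtype.ext (hD x)
  have hfin : Module.Finite ℤ δ.range :=
    inferInstanceAs (Module.Finite ℤ (LinearMap.range δ.toIntLinearMap))
  obtain ⟨⟨e⟩, hindex⟩ := card_ker_eq_and_index_range_eq δ f hf d fun _ => rfl
  rw [← endoOnRange_sub_one_injective_iff]
  have hcard (hinj : Function.Injective (endoOnRange (φ - 1))) :
      Finite f.ker ∧ (f.range.index : ℚ) = Nat.card f.ker * |g.eval 1| := by
    rw [← abs_det_endoOnRange_sub_one φ hinj m g hchar hg1, Nat.card_congr e, hindex,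
      e.finite_iff]
    exact index_range_eq_card_ker_mul_abs_det q d _ hqd hinj
  have hindex_ne (hinj : Function.Injective (endoOnRange (φ - 1))) : f.range.index ≠ 0 := by
    obtain ⟨hker, heq⟩ := hcard hinj
    rw [← Nat.cast_ne_zero (R := ℚ), heq]
    exact mul_ne_zero (Nat.cast_ne_zero.2 Nat.card_pos.ne') (abs_ne_zero.2 hg1)
  refine ⟨⟨fun hz => ?_, fun hinj => ⟨(hcard hinj).1, ?_⟩⟩, fun hinj => ?_⟩
  · have hker : Finite d.ker := e.finite_iff.1 hz.1
    exact injective_of_finite_ker q d _ hqd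
  · exact Nat.finite_of_card_ne_zero (hindex_ne hinj)
  · have heq := (hcard hinj).2
    have hne : (f.range.index : ℚ) ≠ 0 := Nat.cast_ne_zero.2 (hindex_ne hinj)
    change (Nat.card f.ker : ℚ) / (f.range.index : ℚ) * |g.eval 1| = 1
    rw [div_mul_eq_mul_div, ← heq, div_self hne]
end

section
/- Let k be a finite field of characteristic p. Every F-crystal over k is a quotient of a torsion-free F-crystal: for every F-crystal (M, F_M) over k there exist an F-crystal (N, F_N) over k with N a torsion-free (hence finite free) W(k)-module and a surjective W(k)-linear map π : N → M satisfying π ∘ F_N = F_M ∘ π. -/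
open Submodule

/-- Over an infinite domain, any endomorphism of a finite free module becomes injective after
adding a suitable multiple of a given nonzero scalar. -/
theorem Module.End.exists_injective_add_smul {R P : Type*} [CommRing R] [IsDomain R] [Infinite R]
    [AddCommGroup P] [Module R P] [Module.Free R P] [Module.Finite R P]
    (V : Module.End R P) {a : R} (ha : a ≠ 0) :
    ∃ c : R, Function.Injective (V + (c * a) • LinearMap.id : Module.End R P) := by
  have hinj : Function.Injective fun c : R ↦ -(c * a) := fun c d h ↦
    mul_right_cancel₀ ha (neg_injective h)
  obtain ⟨c, hc⟩ := (V.finite_hasEigenvalue.preimage hinj.injOn).exists_notMem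
  refine ⟨c, (injective_iff_map_eq_zero _).2 fun x hx ↦ ?_⟩
  by_contra hx0
  refine hc (Module.End.hasEigenvalue_of_hasEigenvector
    (Module.End.hasEigenvector_iff.2 ⟨Module.End.mem_eigenspace_iff.2 ?_, hx0⟩))
  rw [neg_smul, eq_neg_iff_add_eq_zero]
  simpa using hx

/-- If the `σ`-semilinear map `F ∘ g` on `ι → R` takes values in the range of `π`, it lifts along
`π` to a linear map precomposed with `σ` applied coordinatewise. -/
theorem Pi.exists_linearMap_semilinear_lift {R ι N M : Type*} [CommRing R] [Finite ι]
    [AddCommGroup N] [Module R N] [AddCommGroup M] [Module R M] {σ : R →+* R}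
    (F : M →ₛₗ[σ] M) (π : N →ₗ[R] M) (g : (ι → R) →ₗ[R] M)
    (h : ∀ x, F (g x) ∈ LinearMap.range π) :
    ∃ U : (ι → R) →ₗ[R] N, ∀ x, π (U (σ ∘ x)) = F (g x) := by
  classical
  have := Fintype.ofFinite ι
  choose u hu using fun i ↦ h (Pi.single i 1)
  refine ⟨Fintype.linearCombination R u, fun x ↦ ?_⟩
  conv_rhs => rw [pi_eq_sum_univ' x]
  simp [Fintype.linearCombination_apply, hu, map_sum, LinearMap.map_smulₛₗ]

/-- A finite module over a principal ideal domain is covered by a product of two finite free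
modules, the first meeting the torsion trivially and the second covering it. -/
theorem Module.Finite.exists_free_cover_torsion (R M : Type*) [CommRing R] [IsDomain R]
    [IsPrincipalIdealRing R] [AddCommGroup M] [Module R M] [Module.Finite R M] :
    ∃ (n m : ℕ) (f : (Fin n → R) →ₗ[R] M) (g : (Fin m → R) →ₗ[R] M),
      Function.Surjective (f.coprod g) ∧ (∀ x, f x ∈ torsion R M → x = 0) ∧
      LinearMap.range g = torsion R M := by
  let b := Module.finBasis R (M ⧸ torsion R M)
  obtain ⟨s, hs⟩ := Module.projective_lifting_property (torsion R M).mkQ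
    (LinearMap.id : (M ⧸ torsion R M) →ₗ[R] _) (mkQ_surjective _)
  obtain ⟨m, q, hq⟩ := Module.Finite.exists_fin' R (torsion R M)
  have hs' : ∀ y, (torsion R M).mkQ (s y) = y := fun y ↦ LinearMap.congr_fun hs y
  have hg : LinearMap.range ((torsion R M).subtype ∘ₗ q) = torsion R M := by
    rw [LinearMap.range_comp, LinearMap.range_eq_top.2 hq, Submodule.map_top, range_subtype]
  refine ⟨_, m, s ∘ₗ b.equivFun.symm.toLinearMap, (torsion R M).subtype ∘ₗ q,
    fun y ↦ ?_, fun x hx ↦ ?_, hg⟩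
  · have : y - s ((torsion R M).mkQ y) ∈ torsion R M := by
      rw [← Quotient.mk_eq_zero, ← mkQ_apply, map_sub, hs', sub_self]
    obtain ⟨z, hz⟩ := hg.ge this
    exact ⟨(b.equivFun ((torsion R M).mkQ y), z), by
      rw [LinearMap.coprod_apply, hz, LinearMap.comp_apply, LinearEquiv.coe_coe,
        LinearEquiv.symm_apply_apply, add_sub_cancel]⟩
  · rw [← Quotient.mk_eq_zero, ← mkQ_apply, LinearMap.comp_apply, hs'] at hx
    exact (LinearEquiv.map_eq_zero_iff _).1 hx

/-- Over an infinite principal ideal domain with an injective endomorphism `σ`, a finite module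
with a `σ`-semilinear endomorphism with torsion kernel is a quotient of a finite free module with
an injective one. -/
theorem LinearMap.exists_injective_semilinear_cover {R M : Type*} [CommRing R] [IsDomain R]
    [IsPrincipalIdealRing R] [Infinite R] [AddCommGroup M] [Module R M] [Module.Finite R M]
    {σ : R →+* R} (hσ : Function.Injective σ) (F : M →ₛₗ[σ] M)
    (hF : ∀ x, F x = 0 → x ∈ torsion R M) :
    ∃ (n m : ℕ) (G : ((Fin n → R) × (Fin m → R)) →ₛₗ[σ] ((Fin n → R) × (Fin m → R)))
      (π : ((Fin n → R) × (Fin m → R)) →ₗ[R] M),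
      Function.Injective G ∧ Function.Surjective π ∧ ∀ x, π (G x) = F (π x) := by
  obtain ⟨n, m, f, g, hsurj, hf, hg⟩ := Module.Finite.exists_free_cover_torsion R M
  have hFt : ∀ x ∈ torsion R M, F x ∈ torsion R M := by
    intro x hx
    obtain ⟨a, ha⟩ := (mem_torsion_iff x).1 hx
    refine (mem_torsion_iff _).2 ⟨⟨σ a, mem_nonZeroDivisors_of_ne_zero ?_⟩, ?_⟩
    · exact (map_ne_zero_iff σ hσ).2 (nonZeroDivisors.ne_zero a.2)
    · change σ a • F x = 0
      rw [← F.map_smulₛₗ, ← map_zero F]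
      exact congrArg F ha
  obtain ⟨a, ha, ha0⟩ := annihilator_top_inter_nonZeroDivisors
    (torsion_isTorsion (R := R) (M := M))
  have hag : ∀ y, a • g y = 0 := fun y ↦ congrArg Subtype.val
    (mem_annihilator.1 ha ⟨g y, hg.le ⟨y, rfl⟩⟩ mem_top)
  obtain ⟨U, hU⟩ := Pi.exists_linearMap_semilinear_lift F (f.coprod g) f fun _ ↦ hsurj _
  obtain ⟨V, hV⟩ := Pi.exists_linearMap_semilinear_lift F g g fun y ↦
    hg.ge (hFt _ (hg.le ⟨y, rfl⟩))
  obtain ⟨c, hc⟩ := Module.End.exists_injective_add_smul V (nonZeroDivisors.ne_zero ha0)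
  let Φ (l : ℕ) : (Fin l → R) →ₛₗ[σ] (Fin l → R) :=
    { toFun := fun x ↦ σ ∘ x
      map_add' := fun x y ↦ by ext; simp
      map_smul' := fun r x ↦ by ext; simp }
  let V' := V + (c * a) • LinearMap.id
  let G := (U.comp (Φ n)).comp (LinearMap.fst R _ _) +
    ((LinearMap.inr R (Fin n → R) _).comp (V'.comp (Φ m))).comp (LinearMap.snd R _ _)
  have hGπ : ∀ x, f.coprod g (G x) = F (f.coprod g x) := by
    rintro ⟨x, y⟩
    have h1 : G (x, y) = U (σ ∘ x) + (0, V' (σ ∘ y)) := rfl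
    have h2 : g (V' (σ ∘ y)) = F (g y) := by
      simp [V', hV, mul_smul, hag]
    rw [h1, map_add, hU, LinearMap.coprod_apply, LinearMap.coprod_apply, map_zero, zero_add,
      h2, map_add]
  refine ⟨n, m, G, f.coprod g, (injective_iff_map_eq_zero G).2 ?_, hsurj, hGπ⟩
  rintro ⟨x, y⟩ hxy
  have ht : f x + g y ∈ torsion R M := hF _ <| by
    simpa [hxy] using (hGπ (x, y)).symm
  obtain rfl : x = 0 := hf x (((torsion R M).add_mem_iff_left (hg.le ⟨y, rfl⟩)).1 ht)
  have h1 : G (0, y) = U (Φ n 0) + (0, V' (Φ m y)) := rfl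
  rw [hxy, map_zero, map_zero, zero_add] at h1
  have h2 : Φ m y = 0 := (injective_iff_map_eq_zero V').1 hc _ (congrArg Prod.snd h1).symm
  have h3 : y = 0 := funext fun i ↦ (map_eq_zero_iff σ hσ).1 (congrFun h2 i)
  rw [h3, Prod.mk_zero_zero]


/-- Let `k` be a finite field of characteristic `p`.  Every `F`-crystal over `k`
(a finitely generated `W(k)`-module `M` with an additive `σ`-semilinear map
`F_M : M → M` whose kernel is torsion) is a quotient of a torsion-free `F`-crystal:
there are a finitely generated torsion-free `W(k)`-module `N`, a `σ`-semilinear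
additive `F_N : N → N` with torsion kernel, and a surjective `W(k)`-linear
`π : N → M` with `π ∘ F_N = F_M ∘ π`. -/
theorem stmt8 (p : ℕ) [Fact p.Prime] (k : Type*) [Field k] [Finite k] [CharP k p]
    {M : Type u} [AddCommGroup M] [Module (WittVector p k) M]
    [Module.Finite (WittVector p k) M]
    (FM : M →+ M)
    (hFM : ∀ (a : WittVector p k) (x : M),
      FM (a • x) = (WittVector.frobenius a) • FM x)
    (hFMker : ∀ x : M, FM x = 0 → x ∈ Submodule.torsion (WittVector p k) M) :
    ∃ (N : Type u) (_ : AddCommGroup N) (_ : Module (WittVector p k) N),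
      Module.Finite (WittVector p k) N ∧
      Submodule.torsion (WittVector p k) N = ⊥ ∧
      ∃ (FN : N →+ N) (π : N →ₗ[WittVector p k] M),
        (∀ (a : WittVector p k) (x : N),
          FN (a • x) = (WittVector.frobenius a) • FN x) ∧
        (∀ x : N, FN x = 0 → x ∈ Submodule.torsion (WittVector p k) N) ∧
        Function.Surjective π ∧
        ∀ x : N, π (FN x) = FM (π x) := by
  have : Small.{u} k := Countable.toSmall k
  have : Small.{u} (WittVector p k) :=
    small_of_injective (f := WittVector.coeff) fun _ _ h ↦ WittVector.ext (congrFun h)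
  have : Infinite (WittVector p k) := not_finite_iff_infinite.1 fun _ ↦
    IsDiscreteValuationRing.not_isField (WittVector p k) (Finite.isField_of_domain _)
  let F : M →ₛₗ[(WittVector.frobenius : WittVector p k →+* _)] M := { FM with map_smul' := hFM }
  obtain ⟨n, m, G, π, hG, hπ, h⟩ := LinearMap.exists_injective_semilinear_cover
    (WittVector.frobenius_bijective p k).injective F hFMker
  let e := Shrink.linearEquiv.{u} (WittVector p k)
    ((Fin n → WittVector p k) × (Fin m → WittVector p k))
  have : Module.Finite (WittVector p k) (Shrink.{u}
    ((Fin n → WittVector p k) × (Fin m → WittVector p k))) := Module.Finite.equiv e.symm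
  have : Module.IsTorsionFree (WittVector p k) (Shrink.{u}
    ((Fin n → WittVector p k) × (Fin m → WittVector p k))) :=
    e.injective.moduleIsTorsionFree e fun _ _ ↦ map_smul e _ _
  let E := e.symm.toLinearMap.comp (G.comp e.toLinearMap)
  refine ⟨_, _, _, ‹_›, isTorsionFree_iff_torsion_eq_bot.1 this,
    E.toAddMonoidHom, π ∘ₗ e.toLinearMap,
    E.map_smulₛₗ, fun x hx ↦ ?_, hπ.comp e.surjective, fun x ↦ ?_⟩
  · have hx' : e.symm (G (e x)) = 0 := hx
    rw [map_eq_zero_iff _ e.symm.injective, map_eq_zero_iff _ hG,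
      map_eq_zero_iff _ e.injective] at hx'
    exact hx' ▸ zero_mem _
  · change π (e (e.symm (G (e x)))) = FM (π (e x))
    rw [e.apply_symm_apply, h]
    rfl
end

section
/- Let k be a finite field of characteristic p, let W(k) be its ring of Witt vectors, regarded as a ℤ_p-algebra via the canonical identification ℤ_p ≅ W(𝔽_p) and the functorial map W(𝔽_p) → W(k), and let G = Aut(k) be the (finite cyclic) group of field automorphisms of k. Then the map W(k) ⊗_{ℤ_p} W(k) → ∏_{σ ∈ G} W(k) sending a ⊗ b to the family (a · W(σ)(b))_{σ ∈ G}, where W(σ) : W(k) → W(k) is the ring automorphism induced functorially by σ, is an isomorphism of rings. -/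
open scoped TensorProduct

variable (p : ℕ) [Fact p.Prime]

/-- The canonical `ℤ_p`-algebra structure on `W(k)` for `k` a field of characteristic
`p`, obtained from the identification `ℤ_p ≅ W(𝔽_p)` and functoriality of Witt
vectors along `𝔽_p = ℤ/p → k`. -/
noncomputable instance wittAlgebra (k : Type*) [Field k] [CharP k p] :
    Algebra ℤ_[p] (WittVector p k) :=
  RingHom.toAlgebra
    ((WittVector.map (ZMod.castHom (dvd_refl p) k)).comp
      (WittVector.equiv p).symm.toRingHom)

section

variable {p} {k : Type*} [Field k]

lemma wittVector_map_mul (σ τ : k ≃+* k) (x : WittVector p k) :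
    WittVector.map ((σ * τ : k ≃+* k) : k →+* k) x =
      WittVector.map (σ : k →+* k) (WittVector.map (τ : k →+* k) x) := by
  ext n
  simp [WittVector.map_coeff]

variable (p k) in
lemma card_ringAut_eq_finrank [Fintype k] [Algebra (ZMod p) k] :
    Nat.card (k ≃+* k) = Module.finrank (ZMod p) k := by
  rw [← IsGalois.card_aut_eq_finrank]
  refine (Nat.card_congr (Equiv.ofBijective (fun f : Gal(k/ZMod p) ↦ f.toRingEquiv)
    ⟨fun f g h ↦ AlgEquiv.ext fun x ↦ RingEquiv.congr_fun h x, fun f ↦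
      ⟨AlgEquiv.ofRingEquiv (f := f) fun r ↦ ?_, rfl⟩⟩)).symm
  exact RingHom.congr_fun
    (Subsingleton.elim ((f : k →+* k).comp (algebraMap (ZMod p) k)) (algebraMap (ZMod p) k)) r

variable [CharP k p]

lemma wittVector_algebraMap_coeff (r : ℤ_[p]) (n : ℕ) :
    (algebraMap ℤ_[p] (WittVector p k) r).coeff n =
      ZMod.castHom (dvd_refl p) k (((WittVector.equiv p).symm r).coeff n) :=
  rfl

/-- A field automorphism of `k` induces a `ℤ_p`-algebra endomorphism of `W(k)`. -/
noncomputable def wittMapAlgHom (σ : k ≃+* k) : WittVector p k →ₐ[ℤ_[p]] WittVector p k where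
  __ := WittVector.map (σ : k →+* k)
  commutes' r := by
    ext n
    change ((σ : k →+* k).comp (ZMod.castHom (dvd_refl p) k)) _ = ZMod.castHom (dvd_refl p) k _
    congr 1
    exact Subsingleton.elim _ _

@[simp]
lemma wittMapAlgHom_apply (σ : k ≃+* k) (x : WittVector p k) :
    wittMapAlgHom σ x = WittVector.map (σ : k →+* k) x :=
  rfl

variable [Fintype k]

/-- An element of `k` fixed by all automorphisms lies in the prime field. -/
lemma mem_range_castHom_of_fixed (x : k) (hx : ∀ σ : k ≃+* k, σ x = x) :
    x ∈ Set.range (ZMod.castHom (dvd_refl p) k) := by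
  let : Algebra (ZMod p) k := ZMod.algebra k p
  obtain ⟨y, hy⟩ := (IsGalois.mem_range_algebraMap_iff_fixed (F := ZMod p) x).2
    fun f ↦ hx f.toRingEquiv
  exact ⟨y, hy⟩

/-- A Witt vector fixed by all `W(σ)` is a `p`-adic integer. -/
lemma mem_range_algebraMap_of_fixed (x : WittVector p k)
    (hx : ∀ σ : k ≃+* k, WittVector.map (σ : k →+* k) x = x) :
    x ∈ Set.range (algebraMap ℤ_[p] (WittVector p k)) := by
  have h (n : ℕ) : x.coeff n ∈ Set.range (ZMod.castHom (dvd_refl p) k) :=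
    mem_range_castHom_of_fixed _ fun σ ↦ by
      simpa [WittVector.map_coeff] using congrArg (fun y ↦ y.coeff n) (hx σ)
  choose c hc using h
  refine ⟨WittVector.equiv p (WittVector.mk p c), ?_⟩
  ext n
  rw [wittVector_algebraMap_coeff, RingEquiv.symm_apply_apply, ← hc n]
  rfl

variable (p k) in
/-- There is a family in `W(k)` indexed by the automorphisms of `k` whose matrix of conjugates is
invertible. -/
lemma exists_isUnit_conjugateMatrix [Fintype (k ≃+* k)] [DecidableEq (k ≃+* k)] :
    ∃ b : (k ≃+* k) → WittVector p k,
      IsUnit (Matrix.of fun σ τ : k ≃+* k ↦ WittVector.map (σ : k →+* k) (b τ)) := by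
  let : Algebra (ZMod p) k := ZMod.algebra k p
  let B : Module.Basis (k ≃+* k) (ZMod p) k :=
    (Module.finBasis (ZMod p) k).reindex <| Fintype.equivOfCardEq <| by
      rw [Fintype.card_fin, ← card_ringAut_eq_finrank p k, Nat.card_eq_fintype_card]
  choose b hb using fun τ ↦ WittVector.constantCoeff_surjective p (B τ)
  refine ⟨b, (Matrix.isUnit_iff_isUnit_det _).2 <|
    WittVector.isUnit_of_coeff_zero_ne_zero _ ?_⟩
  set N : Matrix (k ≃+* k) (k ≃+* k) k := Matrix.of fun σ τ ↦ σ (B τ)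
  have hN : IsUnit N := by
    refine Matrix.vecMul_injective_iff_isUnit.1 <|
      (injective_iff_map_eq_zero (Matrix.vecMulLinear N)).2 fun c hc ↦ ?_
    have hli : LinearIndependent k fun σ : k ≃+* k ↦ (σ : k → k) :=
      (linearIndependent_monoidHom k k).comp (fun σ : k ≃+* k ↦ ((σ : k →+* k) : k →* k))
        fun σ τ h ↦ RingEquiv.ext fun x ↦ DFunLike.congr_fun h x
    refine funext (Fintype.linearIndependent_iff.1 hli c ?_)
    let L : k →+ k := ∑ σ : k ≃+* k, (AddMonoidHom.mulLeft (c σ)).comp (σ : k →+ k)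
    have hL : L.toZModLinearMap p = 0 := B.ext fun τ ↦ by
      simpa [L, N, Matrix.vecMul, dotProduct] using congrFun hc τ
    funext x
    simpa [L] using LinearMap.congr_fun hL x
  have hdet : (Matrix.of fun σ τ : k ≃+* k ↦ WittVector.map (σ : k →+* k) (b τ)).det.coeff 0 =
      N.det := by
    rw [← WittVector.constantCoeff_apply, RingHom.map_det]
    congr 1
    ext σ τ
    simp [N, ← hb]
  rw [hdet]
  exact ((Matrix.isUnit_iff_isUnit_det _).1 hN).ne_zero

/-- A family in `W(k)` with invertible matrix of conjugates spans `W(k)` over `ℤ_p`. -/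
lemma exists_sum_smul_eq_of_isUnit [Fintype (k ≃+* k)] [DecidableEq (k ≃+* k)]
    {b : (k ≃+* k) → WittVector p k}
    (hb : IsUnit (Matrix.of fun σ τ : k ≃+* k ↦ WittVector.map (σ : k →+* k) (b τ)))
    (w : WittVector p k) : ∃ c : (k ≃+* k) → ℤ_[p], ∑ τ, c τ • b τ = w := by
  obtain ⟨c, hc⟩ := (Matrix.mulVec_surjective_iff_isUnit.2 hb)
    fun σ ↦ WittVector.map (σ : k →+* k) w
  have hc' (σ : k ≃+* k) : ∑ τ, WittVector.map (σ : k →+* k) (b τ) * c τ =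
      WittVector.map (σ : k →+* k) w := congrFun hc σ
  have hfix (ρ : k ≃+* k) : (fun τ ↦ WittVector.map (ρ : k →+* k) (c τ)) = c := by
    refine Matrix.mulVec_injective_of_isUnit hb (Eq.trans ?_ hc.symm)
    funext σ
    change ∑ τ, WittVector.map (σ : k →+* k) (b τ) * WittVector.map (ρ : k →+* k) (c τ) = _
    obtain ⟨σ, rfl⟩ : ∃ σ', σ = ρ * σ' := ⟨ρ⁻¹ * σ, by simp⟩
    simp only [wittVector_map_mul, ← map_mul, ← map_sum, hc']
  choose d hd using fun τ ↦ mem_range_algebraMap_of_fixed (c τ) fun ρ ↦ congrFun (hfix ρ) τ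
  refine ⟨d, ?_⟩
  have hone (x : WittVector p k) : WittVector.map ((1 : k ≃+* k) : k →+* k) x = x := by
    ext n
    simp [WittVector.map_coeff]
  simpa only [hone, Algebra.smul_def, hd, mul_comm] using hc' 1

end

/-- Let `k` be a finite field of characteristic `p` and `G = Aut(k)` its group of field
automorphisms.  The map `W(k) ⊗_{ℤ_p} W(k) → ∏_{σ ∈ G} W(k)`,
`a ⊗ b ↦ (a · W(σ)(b))_σ`, is an isomorphism of rings. -/
theorem stmt12 (k : Type*) [Field k] [Fintype k] [CharP k p] :
    ∃ e : (WittVector p k ⊗[ℤ_[p]] WittVector p k) ≃+* ((k ≃+* k) → WittVector p k),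
      ∀ (a b : WittVector p k) (σ : k ≃+* k),
        e (a ⊗ₜ[ℤ_[p]] b) σ = a * WittVector.map (σ : k →+* k) b := by
  classical
  have : Finite (k ≃+* k) := Finite.of_injective _ DFunLike.coe_injective
  let : Fintype (k ≃+* k) := Fintype.ofFinite _
  let φ : WittVector p k ⊗[ℤ_[p]] WittVector p k →ₐ[ℤ_[p]] ((k ≃+* k) → WittVector p k) :=
    Algebra.TensorProduct.productMap (Pi.constAlgHom ℤ_[p] (k ≃+* k) (WittVector p k))
      (AlgHom.pi wittMapAlgHom)
  have hφ (a b : WittVector p k) (σ : k ≃+* k) :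
      φ (a ⊗ₜ b) σ = a * WittVector.map (σ : k →+* k) b := by
    simp [φ]
  obtain ⟨b, hb⟩ := exists_isUnit_conjugateMatrix p k
  have hφb (a : (k ≃+* k) → WittVector p k) : φ (∑ τ, a τ ⊗ₜ b τ) =
      (Matrix.of fun σ τ : k ≃+* k ↦ WittVector.map (σ : k →+* k) (b τ)).mulVec a := by
    funext σ
    simp [hφ, Matrix.mulVec, dotProduct, mul_comm]
  have hspan (x : WittVector p k ⊗[ℤ_[p]] WittVector p k) :
      ∃ a : (k ≃+* k) → WittVector p k, ∑ τ, a τ ⊗ₜ b τ = x := by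
    induction x with
    | zero => exact ⟨0, by simp⟩
    | tmul v w =>
      obtain ⟨c, rfl⟩ := exists_sum_smul_eq_of_isUnit hb w
      exact ⟨fun τ ↦ c τ • v, by simp [TensorProduct.tmul_sum, TensorProduct.smul_tmul]⟩
    | add x y hx hy =>
      obtain ⟨a, rfl⟩ := hx
      obtain ⟨a', rfl⟩ := hy
      exact ⟨a + a', by simp [TensorProduct.add_tmul, Finset.sum_add_distrib]⟩
  have hbij : Function.Bijective φ := by
    refine ⟨(injective_iff_map_eq_zero φ).2 fun x hx ↦ ?_, fun y ↦ ?_⟩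
    · obtain ⟨a, rfl⟩ := hspan x
      obtain rfl : a = 0 := Matrix.mulVec_injective_of_isUnit hb <| by
        rw [← hφb, hx, Matrix.mulVec_zero]
      simp
    · obtain ⟨a, ha⟩ := Matrix.mulVec_surjective_iff_isUnit.2 hb y
      exact ⟨_, (hφb a).trans ha⟩
  exact ⟨RingEquiv.ofBijective φ hbij, hφ⟩
end

section
/- Let A and B be finite abelian groups equipped with automorphisms α : A → A and β : B → B, and let φ : A × B → ℚ/ℤ be a bi-additive pairing that is perfect (the induced maps A → Hom(B, ℚ/ℤ) and B → Hom(A, ℚ/ℤ) are isomorphisms) and equivariant in the sense that φ(α(a), β(b)) = φ(a, b) for all a, b. Then φ induces a well-defined pairing ker(α − 1) × coker(β − 1) → ℚ/ℤ, and this induced pairing is perfect. -/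
/-- The group `ℚ/ℤ`. -/
abbrev QmodZ : Type := ℚ ⧸ AddSubgroup.zmultiples (1 : ℚ)

/-- Let `A`, `B` be finite abelian groups with automorphisms `α`, `β`, and let
`φ : A × B → ℚ/ℤ` be a perfect bi-additive pairing with `φ(α a, β b) = φ(a, b)`.
Then `φ` induces a well-defined pairing `ker(α - 1) × coker(β - 1) → ℚ/ℤ`, and this
induced pairing is perfect. -/
theorem stmt13 {A B : Type*} [AddCommGroup A] [AddCommGroup B] [Finite A] [Finite B]
    (α : A ≃+ A) (β : B ≃+ B)
    (φ : A →+ B →+ QmodZ)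
    (hperf : Function.Bijective φ ∧ Function.Bijective φ.flip)
    (hequiv : ∀ (a : A) (b : B), φ (α a) (β b) = φ a b) :
    ∃ ψ : ((α : A →+ A) - AddMonoidHom.id A).ker →+
        (B ⧸ ((β : B →+ B) - AddMonoidHom.id B).range) →+ QmodZ,
      (∀ (a : ((α : A →+ A) - AddMonoidHom.id A).ker) (b : B),
        ψ a (QuotientAddGroup.mk b) = φ (a : A) b) ∧
      Function.Bijective ψ ∧ Function.Bijective ψ.flip := by
  have fixed_apply : ∀ (a : ((α : A →+ A) - AddMonoidHom.id A).ker) (b : B),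
      φ (a : A) (β b) = φ (a : A) b := fun a b ↦ by
    have ha : α (a : A) = a := sub_eq_zero.mp a.2
    simpa only [ha] using hequiv (a : A) b
  have range_le : ((β : B →+ B) - AddMonoidHom.id B).range ≤
      (φ.comp ((α : A →+ A) - AddMonoidHom.id A).ker.subtype).flip.ker := by
    rintro _ ⟨b, rfl⟩
    ext a
    change φ (a : A) (β b - b) = 0
    rw [map_sub, fixed_apply, sub_self]
  let ψ := (QuotientAddGroup.lift _ _ range_le).flip
  have ψ_mk : ∀ (a : ((α : A →+ A) - AddMonoidHom.id A).ker) (b : B),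
      ψ a (QuotientAddGroup.mk b) = φ (a : A) b := fun _ _ ↦ rfl
  have ψ_surjective : Function.Surjective ψ := by
    intro f
    obtain ⟨a, ha⟩ := hperf.1.2 (f.comp (QuotientAddGroup.mk' _))
    have hab : ∀ b, φ a b = f (QuotientAddGroup.mk b) := fun b ↦ DFunLike.congr_fun ha b
    have fixed : α a = a := by
      apply hperf.1.1
      ext b
      obtain ⟨b, rfl⟩ := β.surjective b
      rw [hequiv, hab, hab]
      congr 1
      exact QuotientAddGroup.eq.mpr ⟨b, (neg_add_eq_sub b (β b)).symm⟩
    refine ⟨⟨a, sub_eq_zero.mpr fixed⟩, ?_⟩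
    ext b
    exact hab b
  refine ⟨ψ, ψ_mk, ⟨?_, ψ_surjective⟩, ?_, ?_⟩
  · intro a a' h
    apply Subtype.ext
    apply hperf.1.1
    ext b
    exact DFunLike.congr_fun h (QuotientAddGroup.mk b)
  · rw [injective_iff_map_eq_zero]
    intro x hx
    refine CharacterModule.eq_zero_of_character_apply fun c ↦ ?_
    obtain ⟨a, rfl⟩ := ψ_surjective c
    exact DFunLike.congr_fun hx a
  · intro g
    obtain ⟨f, hf⟩ := CharacterModule.dual_surjective_of_injective
      ((α : A →+ A) - AddMonoidHom.id A).ker.subtype.toIntLinearMap Subtype.val_injective g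
    obtain ⟨b, hb⟩ := hperf.2.2 f
    refine ⟨QuotientAddGroup.mk b, ?_⟩
    ext a
    exact (DFunLike.congr_fun hb (a : A)).trans (DFunLike.congr_fun hf a)
end

section
/- Let ℓ be a prime, let N be a finite free ℤℓ-module, and let M be a ℤℓ-module of finite cardinality. Let Tr : Hom_{ℤℓ}(N, N ⊗_{ℤℓ} ℚℓ/ℤℓ) → ℚℓ/ℤℓ be the map obtained from the trace End_{ℤℓ}(N) → ℤℓ by tensoring with ℚℓ/ℤℓ under the canonical isomorphism Hom_{ℤℓ}(N, N ⊗_{ℤℓ} ℚℓ/ℤℓ) ≅ End_{ℤℓ}(N) ⊗_{ℤℓ} ℚℓ/ℤℓ (valid since N is finite free). Then the pairing Hom_{ℤℓ}(N, M) × Hom_{ℤℓ}(M, N ⊗_{ℤℓ} ℚℓ/ℤℓ) → ℚℓ/ℤℓ given by (f, g) ↦ Tr(g ∘ f) is a perfect pairing of finite abelian groups. -/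
open scoped TensorProduct

variable (ℓ : ℕ) [Fact ℓ.Prime]

/-- The `ℤℓ`-module `ℚℓ/ℤℓ`. -/
abbrev QlmodZl : Type := ℚ_[ℓ] ⧸ LinearMap.range (Algebra.linearMap ℤ_[ℓ] ℚ_[ℓ])

namespace QlmodZl

/-- The class of `1 / ℓ ^ k` in `ℚℓ/ℤℓ`. -/
noncomputable def invPow (k : ℕ) : QlmodZl ℓ :=
  Submodule.Quotient.mk (((ℓ : ℚ_[ℓ]) ^ k)⁻¹)

variable {ℓ}

lemma nsmul_invPow_eq_zero_iff (k n : ℕ) : n • invPow ℓ k = 0 ↔ ℓ ^ k ∣ n := by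
  have hℓ : (ℓ : ℚ_[ℓ]) ≠ 0 := Nat.cast_ne_zero.2 (Fact.out : ℓ.Prime).ne_zero
  rw [invPow, ← Submodule.Quotient.mk_smul, Submodule.Quotient.mk_eq_zero, LinearMap.mem_range]
  constructor
  · rintro ⟨y, hy⟩
    have h : ((n : ℤ) : ℤ_[ℓ]) = (ℓ : ℤ_[ℓ]) ^ k * y := by
      apply PadicInt.ext
      have hy' : (y : ℚ_[ℓ]) = (n : ℚ_[ℓ]) * ((ℓ : ℚ_[ℓ]) ^ k)⁻¹ := by
        rw [← nsmul_eq_mul]; exact hy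
      push_cast
      rw [hy']
      field_simp
    have h' : (ℓ : ℤ_[ℓ]) ^ k ∣ ((n : ℤ) : ℤ_[ℓ]) := ⟨y, h⟩
    rw [← Ideal.mem_span_singleton, ← PadicInt.norm_le_pow_iff_mem_span_pow,
      PadicInt.norm_int_le_pow_iff_dvd] at h'
    exact_mod_cast h'
  · rintro ⟨m, rfl⟩
    refine ⟨m, ?_⟩
    rw [nsmul_eq_mul]
    push_cast
    rw [Algebra.linearMap_apply, map_natCast]
    field_simp

lemma exists_nsmul_invPow_eq {k : ℕ} {x : QlmodZl ℓ} (hx : ℓ ^ k • x = 0) :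
    ∃ n : ℕ, n • invPow ℓ k = x := by
  have hℓ : (ℓ : ℚ_[ℓ]) ≠ 0 := Nat.cast_ne_zero.2 (Fact.out : ℓ.Prime).ne_zero
  obtain ⟨q, rfl⟩ := Submodule.Quotient.mk_surjective _ x
  rw [← Submodule.Quotient.mk_smul, Submodule.Quotient.mk_eq_zero, LinearMap.mem_range] at hx
  obtain ⟨r, hr⟩ := hx
  have hr' : (r : ℚ_[ℓ]) = (ℓ : ℚ_[ℓ]) ^ k * q := by
    have : (r : ℚ_[ℓ]) = (ℓ ^ k) • q := hr
    rw [this, nsmul_eq_mul]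
    push_cast
    rfl
  obtain ⟨s, hs⟩ := Ideal.mem_span_singleton.1 (PadicInt.appr_spec k r)
  refine ⟨r.appr k, ?_⟩
  rw [invPow, ← Submodule.Quotient.mk_smul, Submodule.Quotient.eq, LinearMap.mem_range]
  refine ⟨-s, ?_⟩
  have hs' := congrArg (fun z : ℤ_[ℓ] => (z : ℚ_[ℓ])) hs
  push_cast at hs'
  rw [hr'] at hs'
  change ((-s : ℤ_[ℓ]) : ℚ_[ℓ]) = _
  rw [nsmul_eq_mul]
  push_cast
  field_simp
  linear_combination hs'

instance hasEnoughRootsOfUnity (k : ℕ) :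
    HasEnoughRootsOfUnity (Multiplicative (QlmodZl ℓ)) (ℓ ^ k) where
  prim := ⟨.ofAdd (invPow ℓ k),
    by rw [← ofAdd_nsmul, (nsmul_invPow_eq_zero_iff k _).2 dvd_rfl, ofAdd_zero],
    fun n hn => by
      rwa [← ofAdd_nsmul, ← ofAdd_zero, Equiv.apply_eq_iff_eq, nsmul_invPow_eq_zero_iff] at hn⟩
  cyc := by
    have hζ : toUnits (Multiplicative.ofAdd (invPow ℓ k)) ∈
        rootsOfUnity (ℓ ^ k) (Multiplicative (QlmodZl ℓ)) := by
      rw [mem_rootsOfUnity, ← map_pow, ← ofAdd_nsmul, (nsmul_invPow_eq_zero_iff k _).2 dvd_rfl,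
        ofAdd_zero, map_one]
    refine ⟨⟨_, hζ⟩, fun ⟨u, hu⟩ => ?_⟩
    obtain ⟨x, rfl⟩ := toUnits.surjective u
    rw [mem_rootsOfUnity, ← map_pow, EmbeddingLike.map_eq_one_iff] at hu
    obtain ⟨n, hn⟩ := exists_nsmul_invPow_eq (x := x.toAdd) (k := k) hu
    refine ⟨n, Subtype.ext ?_⟩
    change toUnits (Multiplicative.ofAdd (invPow ℓ k)) ^ (n : ℤ) = toUnits x
    rw [zpow_natCast, ← map_pow, ← ofAdd_nsmul, hn, ofAdd_toAdd]

end QlmodZl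

section FiniteModule

variable (A : Type*) [AddCommGroup A] [Module ℤ_[ℓ] A] [Finite A]

lemma PadicInt.exists_pow_nsmul_eq_zero : ∃ k : ℕ, ∀ a : A, ℓ ^ k • a = 0 := by
  obtain ⟨k, m, hm, hcard⟩ := Nat.exists_eq_pow_mul_and_not_dvd (Nat.card_pos (α := A)).ne' ℓ
    (Fact.out : ℓ.Prime).ne_one
  refine ⟨k, fun a => ?_⟩
  have hu : IsUnit (m : ℤ_[ℓ]) := by
    rw [PadicInt.isUnit_iff, PadicInt.norm_natCast_eq_one_iff]
    exact ((Fact.out : ℓ.Prime).coprime_iff_not_dvd).2 hm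
  have h : (m : ℤ_[ℓ]) • ℓ ^ k • a = 0 := by
    rw [Nat.cast_smul_eq_nsmul, smul_smul, mul_comm, ← hcard, card_nsmul_eq_zero']
  exact hu.smul_eq_zero.1 h

lemma PadicInt.hasEnoughRootsOfUnity_exponent :
    HasEnoughRootsOfUnity (Multiplicative (QlmodZl ℓ)) (Monoid.exponent (Multiplicative A)) := by
  obtain ⟨k, hk⟩ := PadicInt.exists_pow_nsmul_eq_zero ℓ A
  have : NeZero (ℓ ^ k) := ⟨pow_ne_zero _ (Fact.out : ℓ.Prime).ne_zero⟩
  exact HasEnoughRootsOfUnity.of_dvd _ (n := ℓ ^ k)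
    (Monoid.exponent_dvd_of_forall_pow_eq_one fun a => hk a.toAdd)

/-- Additive maps into `ℚℓ/ℤℓ` as characters with values in the units of a monoid. -/
noncomputable def addMonoidHomEquivUnits :
    (A →+ QlmodZl ℓ) ≃ (Multiplicative A →* (Multiplicative (QlmodZl ℓ))ˣ) :=
  AddMonoidHom.toMultiplicative.trans toUnits.monoidHomCongrRightEquiv

lemma nonempty_addMonoidHom_equiv : Nonempty ((A →+ QlmodZl ℓ) ≃ A) := by
  have := PadicInt.hasEnoughRootsOfUnity_exponent ℓ A
  obtain ⟨e⟩ := CommGroup.monoidHom_mulEquiv_of_hasEnoughRootsOfUnity (Multiplicative A)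
    (Multiplicative (QlmodZl ℓ))
  exact ⟨(addMonoidHomEquivUnits ℓ A).trans (e.toEquiv.trans Multiplicative.toAdd)⟩

variable {A}

lemma exists_addMonoidHom_apply_ne_zero {a : A} (ha : a ≠ 0) :
    ∃ φ : A →+ QlmodZl ℓ, φ a ≠ 0 := by
  have := PadicInt.hasEnoughRootsOfUnity_exponent ℓ A
  obtain ⟨φ, hφ⟩ := CommGroup.exists_apply_ne_one_of_hasEnoughRootsOfUnity (Multiplicative A)
    (Multiplicative (QlmodZl ℓ)) (a := .ofAdd a) (by simpa using ha)
  refine ⟨(addMonoidHomEquivUnits ℓ A).symm φ, fun h => hφ (toUnits.symm.injective ?_)⟩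
  rw [map_one]
  exact h

/-- An additive map between `ℤℓ`-modules with finite source is `ℤℓ`-linear. -/
def AddMonoidHom.toPadicIntLinearMap {B : Type*} [AddCommGroup B] [Module ℤ_[ℓ] B] (φ : A →+ B) :
    A →ₗ[ℤ_[ℓ]] B where
  toFun := φ
  map_add' := map_add φ
  map_smul' r a := by
    obtain ⟨k, hk⟩ := PadicInt.exists_pow_nsmul_eq_zero ℓ A
    obtain ⟨s, hs⟩ := Ideal.mem_span_singleton.1 (PadicInt.appr_spec k r)
    rw [sub_eq_iff_eq_add, mul_comm] at hs
    have hA : (ℓ : ℤ_[ℓ]) ^ k • a = 0 := by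
      rw [← Nat.cast_pow, Nat.cast_smul_eq_nsmul, hk]
    have hB : (ℓ : ℤ_[ℓ]) ^ k • φ a = 0 := by
      rw [← Nat.cast_pow, Nat.cast_smul_eq_nsmul, ← map_nsmul, hk, map_zero]
    rw [RingHom.id_apply, hs, add_smul, add_smul, mul_smul, mul_smul, hA, hB, smul_zero, smul_zero,
      zero_add, zero_add, Nat.cast_smul_eq_nsmul, Nat.cast_smul_eq_nsmul, map_nsmul]

lemma exists_linearMap_apply_ne_zero {a : A} (ha : a ≠ 0) :
    ∃ φ : A →ₗ[ℤ_[ℓ]] QlmodZl ℓ, φ a ≠ 0 := by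
  obtain ⟨φ, hφ⟩ := exists_addMonoidHom_apply_ne_zero ℓ ha
  exact ⟨φ.toPadicIntLinearMap ℓ, hφ⟩

end FiniteModule

section Trace

variable {R N Q : Type*} [CommRing R] [AddCommGroup N] [Module R N]
  [AddCommGroup Q] [Module R Q]

lemma Module.Basis.eq_sum_tmul_lid_rTensor_coord {ι : Type*} [Fintype ι] (b : Module.Basis ι R N)
    (t : N ⊗[R] Q) :
    t = ∑ i, b i ⊗ₜ[R] TensorProduct.lid R Q ((b.coord i).rTensor Q t) := by
  induction t with
  | zero => simp
  | tmul n q =>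
    simp only [LinearMap.rTensor_tmul, TensorProduct.lid_tmul, ← TensorProduct.smul_tmul,
      ← TensorProduct.sum_tmul, b.coord_apply, b.sum_repr]
  | add x y hx hy =>
    simp only [map_add, TensorProduct.tmul_add, Finset.sum_add_distrib]
    rw [← hx, ← hy]

variable [Module.Finite R N] [Module.Free R N] (T : (N →ₗ[R] N ⊗[R] Q) →ₗ[R] Q)

lemma trace_tensor_smulRight
    (hT : ∀ (f : N →ₗ[R] N) (q : Q),
      T (((TensorProduct.mk R N Q).flip q).comp f) = LinearMap.trace R N f • q)
    (l : N →ₗ[R] R) (t : N ⊗[R] Q) :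
    T (l.smulRight t) = TensorProduct.lid R Q (l.rTensor Q t) := by
  induction t with
  | zero => simp
  | tmul n q =>
    have h : l.smulRight (n ⊗ₜ[R] q) =
        ((TensorProduct.mk R N Q).flip q).comp (l.smulRight n) := by
      ext x
      simp [TensorProduct.smul_tmul']
    rw [h, hT, LinearMap.trace_smulRight, LinearMap.rTensor_tmul, TensorProduct.lid_tmul]
  | add x y hx hy =>
    have h : l.smulRight (x + y) = l.smulRight x + l.smulRight y := by
      ext z
      simp
    rw [h, map_add, hx, hy, map_add, map_add]

lemma trace_tensor_mk_comp
    (hT : ∀ (f : N →ₗ[R] N) (q : Q),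
      T (((TensorProduct.mk R N Q).flip q).comp f) = LinearMap.trace R N f • q)
    (y : N) (ψ : N →ₗ[R] Q) :
    T ((TensorProduct.mk R N Q y).comp ψ) = ψ y := by
  let b := Module.Free.chooseBasis R N
  have h : (TensorProduct.mk R N Q y).comp ψ =
      ∑ i, (b.coord i).smulRight (y ⊗ₜ[R] ψ (b i)) := by
    refine b.ext fun j => ?_
    classical
    simp [LinearMap.sum_apply, Finsupp.single_apply, ite_smul]
  rw [h, map_sum]
  simp only [trace_tensor_smulRight T hT, LinearMap.rTensor_tmul, TensorProduct.lid_tmul,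
    b.coord_apply, ← map_smul, ← map_sum, b.sum_repr]

end Trace

/-- Let `N` be a finite free `ℤℓ`-module, `M` a `ℤℓ`-module of finite cardinality, and
`Tr : Hom(N, N ⊗ ℚℓ/ℤℓ) → ℚℓ/ℤℓ` the map obtained from the trace `End(N) → ℤℓ` by
tensoring with `ℚℓ/ℤℓ` (so `Tr` sends `x ↦ f x ⊗ q` to `trace(f) • q`).  Then the
pairing `Hom(N, M) × Hom(M, N ⊗ ℚℓ/ℤℓ) → ℚℓ/ℤℓ`, `(f, g) ↦ Tr (g ∘ f)`, is a
perfect pairing of finite abelian groups. -/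
theorem stmt14 {N M : Type*} [AddCommGroup N] [Module ℤ_[ℓ] N]
    [Module.Finite ℤ_[ℓ] N] [Module.Free ℤ_[ℓ] N]
    [AddCommGroup M] [Module ℤ_[ℓ] M] [Finite M]
    (Tr : (N →ₗ[ℤ_[ℓ]] (N ⊗[ℤ_[ℓ]] QlmodZl ℓ)) →ₗ[ℤ_[ℓ]] QlmodZl ℓ)
    (hTr : ∀ (f : N →ₗ[ℤ_[ℓ]] N) (q : QlmodZl ℓ),
      Tr (((TensorProduct.mk ℤ_[ℓ] N (QlmodZl ℓ)).flip q).comp f) =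
        (LinearMap.trace ℤ_[ℓ] N f) • q) :
    Finite (N →ₗ[ℤ_[ℓ]] M) ∧ Finite (M →ₗ[ℤ_[ℓ]] (N ⊗[ℤ_[ℓ]] QlmodZl ℓ)) ∧
    Function.Bijective (fun f : N →ₗ[ℤ_[ℓ]] M =>
      AddMonoidHom.mk' (fun g : M →ₗ[ℤ_[ℓ]] (N ⊗[ℤ_[ℓ]] QlmodZl ℓ) => Tr (g.comp f))
        (fun g g' => by simp [LinearMap.add_comp])) ∧
    Function.Bijective (fun g : M →ₗ[ℤ_[ℓ]] (N ⊗[ℤ_[ℓ]] QlmodZl ℓ) =>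
      AddMonoidHom.mk' (fun f : N →ₗ[ℤ_[ℓ]] M => Tr (g.comp f))
        (fun f f' => by simp [LinearMap.comp_add])) := by
  let b := Module.Free.chooseBasis ℤ_[ℓ] N
  have hfin : Finite (N →ₗ[ℤ_[ℓ]] M) :=
    .of_injective (fun f i => f (b i)) fun f g h => b.ext fun i => congrFun h i
  let Φ : (N →ₗ[ℤ_[ℓ]] M) → (M →ₗ[ℤ_[ℓ]] (N ⊗[ℤ_[ℓ]] QlmodZl ℓ)) →+ QlmodZl ℓ := fun f =>
    AddMonoidHom.mk' (fun g => Tr (g.comp f)) (fun g g' => by simp [LinearMap.add_comp])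
  let Ψ : (M →ₗ[ℤ_[ℓ]] (N ⊗[ℤ_[ℓ]] QlmodZl ℓ)) → (N →ₗ[ℤ_[ℓ]] M) →+ QlmodZl ℓ := fun g =>
    AddMonoidHom.mk' (fun f => Tr (g.comp f)) (fun f f' => by simp [LinearMap.comp_add])
  have hΦ : Function.Injective Φ := fun f f' h => by
    ext y
    by_contra hne
    obtain ⟨φ, hφ⟩ := exists_linearMap_apply_ne_zero ℓ (sub_ne_zero.2 hne)
    have h' : Tr (((TensorProduct.mk ℤ_[ℓ] N (QlmodZl ℓ) y).comp φ).comp f) =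
        Tr (((TensorProduct.mk ℤ_[ℓ] N (QlmodZl ℓ) y).comp φ).comp f') :=
      DFunLike.congr_fun h ((TensorProduct.mk ℤ_[ℓ] N (QlmodZl ℓ) y).comp φ)
    rw [LinearMap.comp_assoc, LinearMap.comp_assoc, trace_tensor_mk_comp Tr hTr,
      trace_tensor_mk_comp Tr hTr, LinearMap.comp_apply, LinearMap.comp_apply] at h'
    exact hφ (by rw [map_sub, h', sub_self])
  have hΨ : Function.Injective Ψ := fun g g' h => by
    ext m
    rw [b.eq_sum_tmul_lid_rTensor_coord (g m), b.eq_sum_tmul_lid_rTensor_coord (g' m)]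
    refine Finset.sum_congr rfl fun i _ => ?_
    have h' : Tr (g.comp ((b.coord i).smulRight m)) = Tr (g'.comp ((b.coord i).smulRight m)) :=
      DFunLike.congr_fun h ((b.coord i).smulRight m)
    have hcomp (u : M →ₗ[ℤ_[ℓ]] (N ⊗[ℤ_[ℓ]] QlmodZl ℓ)) :
        u.comp ((b.coord i).smulRight m) = (b.coord i).smulRight (u m) := by
      ext x
      simp
    rw [hcomp, hcomp, trace_tensor_smulRight Tr hTr, trace_tensor_smulRight Tr hTr] at h'
    rw [h']
  obtain ⟨e⟩ := nonempty_addMonoidHom_equiv ℓ (N →ₗ[ℤ_[ℓ]] M)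
  have hfin' : Finite (M →ₗ[ℤ_[ℓ]] (N ⊗[ℤ_[ℓ]] QlmodZl ℓ)) :=
    .of_injective (e ∘ Ψ) (e.injective.comp hΨ)
  obtain ⟨e'⟩ := nonempty_addMonoidHom_equiv ℓ (M →ₗ[ℤ_[ℓ]] (N ⊗[ℤ_[ℓ]] QlmodZl ℓ))
  have hcard : Nat.card (N →ₗ[ℤ_[ℓ]] M) = Nat.card (M →ₗ[ℤ_[ℓ]] (N ⊗[ℤ_[ℓ]] QlmodZl ℓ)) :=
    le_antisymm (Nat.card_le_card_of_injective _ (e'.injective.comp hΦ))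
      (Nat.card_le_card_of_injective _ (e.injective.comp hΨ))
  have : Finite ((N →ₗ[ℤ_[ℓ]] M) →+ QlmodZl ℓ) := .of_equiv _ e.symm
  have : Finite ((M →ₗ[ℤ_[ℓ]] (N ⊗[ℤ_[ℓ]] QlmodZl ℓ)) →+ QlmodZl ℓ) := .of_equiv _ e'.symm
  exact ⟨hfin, hfin',
    (Nat.bijective_iff_injective_and_card Φ).2 ⟨hΦ, hcard.trans (Nat.card_congr e').symm⟩,
    (Nat.bijective_iff_injective_and_card Ψ).2 ⟨hΨ, hcard.symm.trans (Nat.card_congr e).symm⟩⟩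
end

section
/- Let A, B, C be abelian categories and let F : A → C and G : B → C be exact (additive) functors. Consider the fibre product category A ×_C B whose objects are triples (X, Y, γ) with X an object of A, Y an object of B, and γ : F(X) → G(Y) an isomorphism in C, and whose morphisms (X, Y, γ) → (X', Y', γ') are pairs (a : X → X', b : Y → Y') with γ' ∘ F(a) = G(b) ∘ γ. Then A ×_C B is an abelian category, and a composable pair of morphisms in A ×_C B forms an exact sequence if and only if its component sequences in A and in B are exact. -/
open CategoryTheory CategoryTheory.Limits

universe v₁ v₂ v₃ u₁ u₂ u₃

variable {A : Type u₁} {B : Type u₂} {C : Type u₃}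
  [Category.{v₁} A] [Category.{v₂} B] [Category.{v₃} C]

/-- An object of the fibre product category `A ×_C B` of `F : A ⥤ C` and `G : B ⥤ C`:
a triple `(X, Y, γ)` with `γ : F.obj X ≅ G.obj Y`. -/
structure FibreProduct (F : A ⥤ C) (G : B ⥤ C) : Type max u₁ u₂ v₃ where
  left : A
  right : B
  iso : F.obj left ≅ G.obj right

namespace FibreProduct

variable {F : A ⥤ C} {G : B ⥤ C}

/-- A morphism in the fibre product category: a pair `(a, b)` compatible with the
structure isomorphisms. -/
@[ext]
structure Hom (P Q : FibreProduct F G) : Type max v₁ v₂ where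
  a : P.left ⟶ Q.left
  b : P.right ⟶ Q.right
  w : P.iso.hom ≫ G.map b = F.map a ≫ Q.iso.hom

instance : Category (FibreProduct F G) where
  Hom := Hom
  id P := ⟨𝟙 P.left, 𝟙 P.right, by simp⟩
  comp {P Q R} f g :=
    ⟨f.a ≫ g.a, f.b ≫ g.b, by
      rw [F.map_comp, G.map_comp, ← Category.assoc, f.w, Category.assoc, g.w,
        ← Category.assoc]⟩
  id_comp f := Hom.ext (Category.id_comp _) (Category.id_comp _)
  comp_id f := Hom.ext (Category.comp_id _) (Category.comp_id _)
  assoc f g h := Hom.ext (Category.assoc _ _ _) (Category.assoc _ _ _)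

@[simp] lemma comp_a {P Q R : FibreProduct F G} (f : P ⟶ Q) (g : Q ⟶ R) :
    (f ≫ g).a = f.a ≫ g.a := rfl

@[simp] lemma comp_b {P Q R : FibreProduct F G} (f : P ⟶ Q) (g : Q ⟶ R) :
    (f ≫ g).b = f.b ≫ g.b := rfl

section Preadditive

variable [Preadditive A] [Preadditive B] [Preadditive C] [F.Additive] [G.Additive]

instance homZero (P Q : FibreProduct F G) : Zero (P ⟶ Q) :=
  ⟨⟨0, 0, by simp⟩⟩

instance homAdd (P Q : FibreProduct F G) : Add (P ⟶ Q) :=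
  ⟨fun f g =>
    ⟨f.a + g.a, f.b + g.b, by
      rw [Functor.map_add, Functor.map_add, Preadditive.comp_add, Preadditive.add_comp,
        f.w, g.w]⟩⟩

instance homNeg (P Q : FibreProduct F G) : Neg (P ⟶ Q) :=
  ⟨fun f =>
    ⟨-f.a, -f.b, by
      rw [Functor.map_neg, Functor.map_neg, Preadditive.comp_neg, Preadditive.neg_comp,
        f.w]⟩⟩

instance homSub (P Q : FibreProduct F G) : Sub (P ⟶ Q) :=
  ⟨fun f g =>
    ⟨f.a - g.a, f.b - g.b, by
      rw [Functor.map_sub, Functor.map_sub, Preadditive.comp_sub, Preadditive.sub_comp,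
        f.w, g.w]⟩⟩

instance homSMulNat (P Q : FibreProduct F G) : SMul ℕ (P ⟶ Q) :=
  ⟨fun n f =>
    ⟨n • f.a, n • f.b, by
      rw [Functor.map_nsmul, Functor.map_nsmul, Preadditive.comp_nsmul,
        Preadditive.nsmul_comp, f.w]⟩⟩

instance homSMulInt (P Q : FibreProduct F G) : SMul ℤ (P ⟶ Q) :=
  ⟨fun n f =>
    ⟨n • f.a, n • f.b, by
      rw [Functor.map_zsmul, Functor.map_zsmul, Preadditive.comp_zsmul,
        Preadditive.zsmul_comp, f.w]⟩⟩

instance homAddCommGroup (P Q : FibreProduct F G) : AddCommGroup (P ⟶ Q) :=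
  Function.Injective.addCommGroup
    (fun f : P ⟶ Q => ((f.a, f.b) : (P.left ⟶ Q.left) × (P.right ⟶ Q.right)))
    (fun f g h => Hom.ext (congrArg Prod.fst h) (congrArg Prod.snd h))
    rfl (fun _ _ => rfl) (fun _ => rfl) (fun _ _ => rfl)
    (fun _ _ => rfl) (fun _ _ => rfl)

@[simp] lemma add_a {P Q : FibreProduct F G} (f g : P ⟶ Q) : (f + g).a = f.a + g.a := rfl

@[simp] lemma add_b {P Q : FibreProduct F G} (f g : P ⟶ Q) : (f + g).b = f.b + g.b := rfl

@[simp] lemma zero_a {P Q : FibreProduct F G} : (0 : P ⟶ Q).a = 0 := rfl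

@[simp] lemma zero_b {P Q : FibreProduct F G} : (0 : P ⟶ Q).b = 0 := rfl

instance : Preadditive (FibreProduct F G) where
  add_comp P Q R f f' g := by
    apply Hom.ext <;> simp [Preadditive.add_comp]
  comp_add P Q R f g g' := by
    apply Hom.ext <;> simp [Preadditive.comp_add]

end Preadditive

end FibreProduct

namespace FibreProduct

variable {F : A ⥤ C} {G : B ⥤ C}

@[ext]
lemma hom_ext {P Q : FibreProduct F G} {f g : P ⟶ Q} (ha : f.a = g.a) (hb : f.b = g.b) :
    f = g :=
  Hom.ext ha hb

@[simp] lemma id_a (P : FibreProduct F G) : Hom.a (𝟙 P) = 𝟙 P.left := rfl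

@[simp] lemma id_b (P : FibreProduct F G) : Hom.b (𝟙 P) = 𝟙 P.right := rfl

variable (F G) in
/-- The projection `A ×_C B ⥤ A`. -/
@[simps]
def fst : FibreProduct F G ⥤ A where
  obj P := P.left
  map f := f.a

variable (F G) in
/-- The projection `A ×_C B ⥤ B`. -/
@[simps]
def snd : FibreProduct F G ⥤ B where
  obj P := P.right
  map f := f.b

variable (F G) in
/-- The structure isomorphisms `γ`, as an isomorphism between the two composites to `C`. -/
@[simps!]
def fstSndIso : fst F G ⋙ F ≅ snd F G ⋙ G :=
  NatIso.ofComponents (fun P => P.iso) (fun f => f.w.symm)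

lemma isIso_of_isIso_components {P Q : FibreProduct F G} (f : P ⟶ Q)
    (ha : IsIso f.a) (hb : IsIso f.b) : IsIso f := by
  have hw : Q.iso.hom ≫ G.map (inv f.b) = F.map (inv f.a) ≫ P.iso.hom := by
    rw [Functor.map_inv, Functor.map_inv, IsIso.comp_inv_eq, Category.assoc, f.w,
      IsIso.inv_hom_id_assoc]
  refine ⟨⟨inv f.a, inv f.b, hw⟩, hom_ext ?_ ?_, hom_ext ?_ ?_⟩
  · exact IsIso.hom_inv_id f.a
  · exact IsIso.hom_inv_id f.b
  · exact IsIso.inv_hom_id f.a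
  · exact IsIso.inv_hom_id f.b

lemma comp_map_comp_map_eq {P Q : FibreProduct F G} (f : P ⟶ Q) {X : A} {Y : B}
    (γ : F.obj X ⟶ G.obj Y) {a : P.left ⟶ X} {a' : X ⟶ Q.left} {b : P.right ⟶ Y}
    {b' : Y ⟶ Q.right} (ha : a ≫ a' = f.a) (hb : b ≫ b' = f.b)
    (w : γ ≫ G.map b' = F.map a' ≫ Q.iso.hom) :
    (P.iso.hom ≫ G.map b) ≫ G.map b' = (F.map a ≫ γ) ≫ G.map b' := by
  rw [Category.assoc, Category.assoc, w, ← G.map_comp, hb, ← F.map_comp_assoc, ha, f.w]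

lemma map_comp_comp_map_eq {P Q : FibreProduct F G} (f : P ⟶ Q) {X : A} {Y : B}
    (γ : F.obj X ⟶ G.obj Y) {a : P.left ⟶ X} {a' : X ⟶ Q.left} {b : P.right ⟶ Y}
    {b' : Y ⟶ Q.right} (ha : a ≫ a' = f.a) (hb : b ≫ b' = f.b)
    (w : F.map a ≫ γ = P.iso.hom ≫ G.map b) :
    F.map a ≫ γ ≫ G.map b' = F.map a ≫ F.map a' ≫ Q.iso.hom := by
  rw [← Category.assoc, w, Category.assoc, ← G.map_comp, hb, ← F.map_comp_assoc, ha, f.w]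

section Limits

variable {J : Type*} [Category* J] (K : J ⥤ FibreProduct F G)

section Cone

variable [PreservesLimit (K ⋙ fst F G) F] [PreservesLimit (K ⋙ snd F G) G]
  {c₁ : Cone (K ⋙ fst F G)} (h₁ : IsLimit c₁) {c₂ : Cone (K ⋙ snd F G)} (h₂ : IsLimit c₂)

/-- The comparison isomorphism between the images in `C` of the limits of the two components. -/
noncomputable def limitIso : F.obj c₁.pt ≅ G.obj c₂.pt :=
  IsLimit.conePointsIsoOfNatIso (isLimitOfPreserves F h₁) (isLimitOfPreserves G h₂)
    (Functor.isoWhiskerLeft K (fstSndIso F G))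

lemma limitIso_hom_map (j : J) :
    (limitIso K h₁ h₂).hom ≫ G.map (c₂.π.app j) = F.map (c₁.π.app j) ≫ (K.obj j).iso.hom :=
  IsLimit.conePointsIsoOfNatIso_hom_comp (isLimitOfPreserves F h₁) (isLimitOfPreserves G h₂)
    (Functor.isoWhiskerLeft K (fstSndIso F G)) j

/-- The cone in `A ×_C B` with prescribed limit cones as components. -/
noncomputable def limitCone : Cone K where
  pt := ⟨c₁.pt, c₂.pt, limitIso K h₁ h₂⟩
  π :=
    { app j := ⟨c₁.π.app j, c₂.π.app j, limitIso_hom_map K h₁ h₂ j⟩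
      naturality _ _ f := hom_ext (c₁.π.naturality f) (c₂.π.naturality f) }

/-- A cone whose components are limit cones is a limit cone. -/
noncomputable def limitConeIsLimit : IsLimit (limitCone K h₁ h₂) where
  lift s :=
    ⟨h₁.lift ((fst F G).mapCone s), h₂.lift ((snd F G).mapCone s), by
      refine (isLimitOfPreserves G h₂).hom_ext fun j => ?_
      have e₁ : h₁.lift ((fst F G).mapCone s) ≫ c₁.π.app j = (s.π.app j).a := h₁.fac _ j
      have e₂ : h₂.lift ((snd F G).mapCone s) ≫ c₂.π.app j = (s.π.app j).b := h₂.fac _ j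
      exact comp_map_comp_map_eq (s.π.app j) (limitIso K h₁ h₂).hom e₁ e₂
        (limitIso_hom_map K h₁ h₂ j)⟩
  fac s j := hom_ext (h₁.fac ((fst F G).mapCone s) j) (h₂.fac ((snd F G).mapCone s) j)
  uniq s m hm := hom_ext
    (h₁.uniq ((fst F G).mapCone s) m.a fun j => congrArg Hom.a (hm j))
    (h₂.uniq ((snd F G).mapCone s) m.b fun j => congrArg Hom.b (hm j))

end Cone

section Cocone

variable [PreservesColimit (K ⋙ fst F G) F] [PreservesColimit (K ⋙ snd F G) G]
  {c₁ : Cocone (K ⋙ fst F G)} (h₁ : IsColimit c₁)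
  {c₂ : Cocone (K ⋙ snd F G)} (h₂ : IsColimit c₂)

/-- The comparison isomorphism between the images in `C` of the colimits of the two
components. -/
noncomputable def colimitIso : F.obj c₁.pt ≅ G.obj c₂.pt :=
  IsColimit.coconePointsIsoOfNatIso (isColimitOfPreserves F h₁) (isColimitOfPreserves G h₂)
    (Functor.isoWhiskerLeft K (fstSndIso F G))

lemma map_colimitIso_hom (j : J) :
    F.map (c₁.ι.app j) ≫ (colimitIso K h₁ h₂).hom = (K.obj j).iso.hom ≫ G.map (c₂.ι.app j) :=
  IsColimit.comp_coconePointsIsoOfNatIso_hom (isColimitOfPreserves F h₁)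
    (isColimitOfPreserves G h₂) (Functor.isoWhiskerLeft K (fstSndIso F G)) j

/-- The cocone in `A ×_C B` with prescribed colimit cocones as components. -/
noncomputable def colimitCocone : Cocone K where
  pt := ⟨c₁.pt, c₂.pt, colimitIso K h₁ h₂⟩
  ι :=
    { app j := ⟨c₁.ι.app j, c₂.ι.app j, (map_colimitIso_hom K h₁ h₂ j).symm⟩
      naturality _ _ f := hom_ext (c₁.ι.naturality f) (c₂.ι.naturality f) }

/-- A cocone whose components are colimit cocones is a colimit cocone. -/
noncomputable def colimitCoconeIsColimit : IsColimit (colimitCocone K h₁ h₂) where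
  desc s :=
    ⟨h₁.desc ((fst F G).mapCocone s), h₂.desc ((snd F G).mapCocone s), by
      refine (isColimitOfPreserves F h₁).hom_ext fun j => ?_
      have e₁ : c₁.ι.app j ≫ h₁.desc ((fst F G).mapCocone s) = (s.ι.app j).a := h₁.fac _ j
      have e₂ : c₂.ι.app j ≫ h₂.desc ((snd F G).mapCocone s) = (s.ι.app j).b := h₂.fac _ j
      exact map_comp_comp_map_eq (s.ι.app j) (colimitIso K h₁ h₂).hom e₁ e₂
        (map_colimitIso_hom K h₁ h₂ j)⟩
  fac s j := hom_ext (h₁.fac ((fst F G).mapCocone s) j) (h₂.fac ((snd F G).mapCocone s) j)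
  uniq s m hm := hom_ext
    (h₁.uniq ((fst F G).mapCocone s) m.a fun j => congrArg Hom.a (hm j))
    (h₂.uniq ((snd F G).mapCocone s) m.b fun j => congrArg Hom.b (hm j))

end Cocone

end Limits

section FiniteLimits

variable [HasFiniteLimits A] [HasFiniteLimits B] [PreservesFiniteLimits F]
  [PreservesFiniteLimits G]

instance : HasFiniteLimits (FibreProduct F G) where
  out _ _ _ := ⟨fun K =>
    ⟨⟨⟨_, limitConeIsLimit K (limit.isLimit (K ⋙ fst F G)) (limit.isLimit (K ⋙ snd F G))⟩⟩⟩⟩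

instance : PreservesFiniteLimits (fst F G) where
  preservesFiniteLimits _ _ _ := ⟨fun {K} =>
    preservesLimit_of_preserves_limit_cone
      (limitConeIsLimit K (limit.isLimit (K ⋙ fst F G)) (limit.isLimit (K ⋙ snd F G)))
      (limit.isLimit (K ⋙ fst F G))⟩

instance : PreservesFiniteLimits (snd F G) where
  preservesFiniteLimits _ _ _ := ⟨fun {K} =>
    preservesLimit_of_preserves_limit_cone
      (limitConeIsLimit K (limit.isLimit (K ⋙ fst F G)) (limit.isLimit (K ⋙ snd F G)))
      (limit.isLimit (K ⋙ snd F G))⟩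

end FiniteLimits

section FiniteColimits

variable [HasFiniteColimits A] [HasFiniteColimits B] [PreservesFiniteColimits F]
  [PreservesFiniteColimits G]

instance : HasFiniteColimits (FibreProduct F G) where
  out _ _ _ := ⟨fun K =>
    ⟨⟨⟨_, colimitCoconeIsColimit K (colimit.isColimit (K ⋙ fst F G))
      (colimit.isColimit (K ⋙ snd F G))⟩⟩⟩⟩

instance : PreservesFiniteColimits (fst F G) where
  preservesFiniteColimits _ _ _ := ⟨fun {K} =>
    preservesColimit_of_preserves_colimit_cocone
      (colimitCoconeIsColimit K (colimit.isColimit (K ⋙ fst F G))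
        (colimit.isColimit (K ⋙ snd F G)))
      (colimit.isColimit (K ⋙ fst F G))⟩

instance : PreservesFiniteColimits (snd F G) where
  preservesFiniteColimits _ _ _ := ⟨fun {K} =>
    preservesColimit_of_preserves_colimit_cocone
      (colimitCoconeIsColimit K (colimit.isColimit (K ⋙ fst F G))
        (colimit.isColimit (K ⋙ snd F G)))
      (colimit.isColimit (K ⋙ snd F G))⟩

end FiniteColimits

instance [Preadditive A] [Preadditive B] [Preadditive C] [F.Additive] [G.Additive] :
    (fst F G).Additive where

instance [Preadditive A] [Preadditive B] [Preadditive C] [F.Additive] [G.Additive] :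
    (snd F G).Additive where

section Abelian

variable [Abelian A] [Abelian B] [Abelian C] [F.Additive] [G.Additive]
  [PreservesFiniteLimits F] [PreservesFiniteColimits F]
  [PreservesFiniteLimits G] [PreservesFiniteColimits G]

instance isIso_coimageImageComparison {P Q : FibreProduct F G} (f : P ⟶ Q) :
    IsIso (Abelian.coimageImageComparison f) := by
  refine isIso_of_isIso_components _ ?_ ?_
  · change IsIso ((fst F G).map (Abelian.coimageImageComparison f))
    rw [Arrow.isIso_iff_isIso_of_isIso
      (Abelian.PreservesCoimageImageComparison.iso (fst F G) f).hom]
    infer_instance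
  · change IsIso ((snd F G).map (Abelian.coimageImageComparison f))
    rw [Arrow.isIso_iff_isIso_of_isIso
      (Abelian.PreservesCoimageImageComparison.iso (snd F G) f).hom]
    infer_instance

noncomputable instance : Abelian (FibreProduct F G) :=
  Abelian.ofCoimageImageComparisonIsIso

lemma exact_iff_exact_map_fst_and_exact_map_snd (S : ShortComplex (FibreProduct F G)) :
    S.Exact ↔ (S.map (fst F G)).Exact ∧ (S.map (snd F G)).Exact := by
  refine ⟨fun h => ⟨h.map _, h.map _⟩, fun ⟨h₁, h₂⟩ => ?_⟩
  rw [S.leftHomologyData.exact_map_iff, IsZero.iff_id_eq_zero] at h₁ h₂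
  rw [S.leftHomologyData.exact_iff, IsZero.iff_id_eq_zero]
  exact hom_ext h₁ h₂

end Abelian

end FibreProduct

/-- Let `A`, `B`, `C` be abelian categories, and `F : A ⥤ C`, `G : B ⥤ C` exact
(additive) functors.  Then the fibre product category `A ×_C B` is abelian, and a
composable pair of morphisms in `A ×_C B` (a short complex) is exact iff its component
sequences in `A` and in `B` are exact. -/
theorem stmt15 [Abelian A] [Abelian B] [Abelian C]
    (F : A ⥤ C) (G : B ⥤ C) [F.Additive] [G.Additive]
    [PreservesFiniteLimits F] [PreservesFiniteColimits F]
    [PreservesFiniteLimits G] [PreservesFiniteColimits G] :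
    Nonempty (Abelian (FibreProduct F G)) ∧
    ∀ S : ShortComplex (FibreProduct F G),
      S.Exact ↔
        ((ShortComplex.mk S.f.a S.g.a (by have h := congrArg FibreProduct.Hom.a S.zero; rwa [FibreProduct.comp_a, FibreProduct.zero_a] at h)).Exact ∧
         (ShortComplex.mk S.f.b S.g.b (by have h := congrArg FibreProduct.Hom.b S.zero; rwa [FibreProduct.comp_b, FibreProduct.zero_b] at h)).Exact) := by
  exact ⟨⟨inferInstance⟩, FibreProduct.exact_iff_exact_map_fst_and_exact_map_snd⟩
end
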